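/- For any x,y ∈ V_* and any n ≥ 1: (1) if d(x,y) < 1/L_n then R_E(x,y) ≤ 4R_n; (2) if R_E(x,y) < R_n/6 then d(x,y) ≤ 3/L_n. Consequently, R_E extends uniquely to a continuous function on K × K, this extension is a metric on K that induces the original (Euclidean) topology of K, and (K equipped with the extension, together with the inclusion of V_*) is the completion of (V_*, R_E). -/

import Mathlib

open scoped BigOperators ENNReal
open Set Filter MeasureTheory

noncomputable section

abbrev E2 : Type := EuclideanSpace ℝ (Fin 2)

/-- The index set `S_l` of the level-`l` thin Sierpinski gasket. -/
def Sset (l : ℕ) : Set (ℕ × ℕ) :=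
  {p | p.1 + p.2 ≤ l - 1 ∧ p.1 * p.2 * (l - 1 - p.1 - p.2) = 0}

/-- The contraction `f^l_i`. -/
def fmap (q : Fin 3 → E2) (l : ℕ) (i : ℕ × ℕ) (x : E2) : E2 :=
  q 0 + ((i.1 : ℝ) / l) • (q 1 - q 0) + ((i.2 : ℝ) / l) • (q 2 - q 0)
    + (l : ℝ)⁻¹ • (x - q 0)

/-- The closed equilateral triangle `△`. -/
def Tri (q : Fin 3 → E2) : Set E2 := convexHull ℝ (Set.range q)

def V0 (q : Fin 3 → E2) : Set E2 := Set.range q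

/-- Words of length `n` (padded by `(0,0)` beyond position `n`). -/
def Wn (l : ℕ → ℕ) (n : ℕ) : Set (ℕ → ℕ × ℕ) :=
  {w | (∀ k, k < n → w k ∈ Sset (l k)) ∧ ∀ k, n ≤ k → w k = (0, 0)}

/-- `wordMap q l w n = f^{l_1}_{w_1} ∘ ⋯ ∘ f^{l_n}_{w_n}` (0-indexed). -/
def wordMap (q : Fin 3 → E2) (l : ℕ → ℕ) (w : ℕ → ℕ × ℕ) : ℕ → E2 → E2
  | 0 => id
  | n + 1 => wordMap q l w n ∘ fmap q (l n) (w n)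

/-- The thin scale irregular Sierpinski gasket `K`. -/
def Gasket (q : Fin 3 → E2) (l : ℕ → ℕ) : Set E2 :=
  ⋂ n, ⋃ w ∈ Wn l n, wordMap q l w n '' Tri q

/-- The cell `K_w = K ∩ f_w(△)`. -/
def Cell (q : Fin 3 → E2) (l : ℕ → ℕ) (n : ℕ) (w : ℕ → ℕ × ℕ) : Set E2 :=
  Gasket q l ∩ wordMap q l w n '' Tri q

def Vn (q : Fin 3 → E2) (l : ℕ → ℕ) (n : ℕ) : Set E2 :=
  ⋃ w ∈ Wn l n, wordMap q l w n '' V0 q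

def Vstar (q : Fin 3 → E2) (l : ℕ → ℕ) : Set E2 := ⋃ n, Vn q l n

def Ln (l : ℕ → ℕ) (n : ℕ) : ℕ := ∏ k ∈ Finset.range n, l k

def Mn (l : ℕ → ℕ) (n : ℕ) : ℕ := ∏ k ∈ Finset.range n, (3 * l k - 3)

def rl (l : ℕ) : ℝ := (2 * (l : ℝ) / 3 + 1 / 9)⁻¹

def Rn (l : ℕ → ℕ) (n : ℕ) : ℝ := ∏ k ∈ Finset.range n, rl (l k)

def Tn (l : ℕ → ℕ) (n : ℕ) : ℝ := (Mn l n : ℝ) / Rn l n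

/-- The basic energy form `E⁰` on `ℝ^{V₀}`. -/
def E0 (q : Fin 3 → E2) (u v : E2 → ℝ) : ℝ :=
  (1 / 2) * ∑ j : Fin 3, ∑ k : Fin 3, (u (q j) - u (q k)) * (v (q j) - v (q k))

/-- The level-`n` energy form `Eⁿ`. -/
def En (q : Fin 3 → E2) (l : ℕ → ℕ) (n : ℕ) (u v : E2 → ℝ) : ℝ :=
  (Rn l n)⁻¹ * ∑ᶠ w ∈ Wn l n, E0 q (u ∘ wordMap q l w n) (v ∘ wordMap q l w n)

/-- The domain `F` of the limit resistance form. -/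
def FDom (q : Fin 3 → E2) (l : ℕ → ℕ) : Set (E2 → ℝ) :=
  {u | ∃ C : ℝ, ∀ n, En q l n u u ≤ C}

/-- The limit form `E(u,v) = lim_n Eⁿ(u,v)`. -/
def EForm (q : Fin 3 → E2) (l : ℕ → ℕ) (u v : E2 → ℝ) : ℝ :=
  limUnder atTop fun n => En q l n u v

/-- The intrinsic (geodesic) distance on `K`, with values in `ℝ≥0∞`. -/
def pdist (q : Fin 3 → E2) (l : ℕ → ℕ) (x y : E2) : ℝ≥0∞ :=
  ⨅ (γ : ℝ → E2) (_ : ContinuousOn γ (Set.Icc 0 1))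
    (_ : Set.MapsTo γ (Set.Icc 0 1) (Gasket q l)) (_ : γ 0 = x) (_ : γ 1 = y),
    eVariationOn γ (Set.Icc 0 1)

def gdist (q : Fin 3 → E2) (l : ℕ → ℕ) (x y : E2) : ℝ := (pdist q l x y).toReal

/-- The set of resistance quotients used to define `R_E`. -/
def REset (q : Fin 3 → E2) (l : ℕ → ℕ) (x y : E2) : Set ℝ :=
  {t | ∃ u ∈ FDom q l, 0 < EForm q l u u ∧ t = (u x - u y) ^ 2 / EForm q l u u}

/-- The resistance metric `R_E`. -/
def RE (q : Fin 3 → E2) (l : ℕ → ℕ) (x y : E2) : ℝ := sSup (REset q l x y)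

/-- Resistance quotients over continuous representatives (i.e. `F` viewed in `C(K)`). -/
def REcSet (q : Fin 3 → E2) (l : ℕ → ℕ) (x y : E2) : Set ℝ :=
  {t | ∃ u ∈ FDom q l, ContinuousOn u (Gasket q l) ∧ 0 < EForm q l u u ∧
    t = (u x - u y) ^ 2 / EForm q l u u}

def REc (q : Fin 3 → E2) (l : ℕ → ℕ) (x y : E2) : ℝ := sSup (REcSet q l x y)

/-- The open `d`-ball in `K`. -/
def Bd (q : Fin 3 → E2) (l : ℕ → ℕ) (x : E2) (s : ℝ) : Set E2 :=
  {y ∈ Gasket q l | gdist q l x y < s}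

/-- The open `R_E`-ball in `K`. -/
def BRc (q : Fin 3 → E2) (l : ℕ → ℕ) (x : E2) (s : ℝ) : Set E2 :=
  {y ∈ Gasket q l | REc q l x y < s}

/-- `Λ^{(k)}_{n,w}`: words within `k` cell-steps of `w`. -/
def Lam (q : Fin 3 → E2) (l : ℕ → ℕ) (n : ℕ) (w : ℕ → ℕ × ℕ) (k : ℕ) :
    Set (ℕ → ℕ × ℕ) :=
  {v ∈ Wn l n | ∃ c : ℕ → ℕ → ℕ × ℕ, c 0 = w ∧ c k = v ∧ (∀ j ≤ k, c j ∈ Wn l n) ∧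
    ∀ j < k, (Cell q l n (c j) ∩ Cell q l n (c (j + 1))).Nonempty}

/-- `U^{(k)}_{n,w}`. -/
def Unwk (q : Fin 3 → E2) (l : ℕ → ℕ) (n : ℕ) (w : ℕ → ℕ × ℕ) (k : ℕ) : Set E2 :=
  ⋃ v ∈ Lam q l n w k, Cell q l n v

def betaZero (l : ℕ → ℕ) : ℝ :=
  ⨅ n : ℕ, Real.logb (l n) (2 * (l n : ℝ) ^ 2 - (5 / 3) * (l n : ℝ) - 1 / 3)

def betaOne (l : ℕ → ℕ) : ℝ :=
  ⨆ n : ℕ, Real.logb (l n) (2 * (l n : ℝ) ^ 2 - (5 / 3) * (l n : ℝ) - 1 / 3)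

def betaM (l : ℕ → ℕ) : ℝ := ⨅ n : ℕ, Real.logb (l n) (3 * (l n : ℝ) - 3)

def betaR (l : ℕ → ℕ) : ℝ := ⨆ n : ℕ, Real.logb (l n) ((rl (l n))⁻¹)

/-- The value of `Ψ` on the interval `[1/L_{n+1}, 1/L_n]`. -/
def psiPiece (l : ℕ → ℕ) (n : ℕ) (s : ℝ) : ℝ :=
  (Tn l (n + 1))⁻¹
    * (1 + ((3 * (l n : ℝ) - 4) / ((l n : ℝ) - 1)) * ((Ln l (n + 1) : ℝ) * s - 1))
    * (1 + (((2 / 3) * (l n : ℝ) - 8 / 9) / ((l n : ℝ) - 1)) * ((Ln l (n + 1) : ℝ) * s - 1))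

/-- `Ψ = Ψ_𝒍` is characterized by these defining clauses. -/
def IsPsi (l : ℕ → ℕ) (Psi : ℝ → ℝ) : Prop :=
  (∀ n : ℕ, ∀ s : ℝ, ((Ln l (n + 1) : ℝ))⁻¹ ≤ s → s ≤ ((Ln l n : ℝ))⁻¹ →
      Psi s = psiPiece l n s) ∧
  (∀ s : ℝ, 1 ≤ s → Psi s = s ^ betaZero l) ∧ Psi 0 = 0

def psiMPiece (l : ℕ → ℕ) (n : ℕ) (s : ℝ) : ℝ :=
  ((Mn l (n + 1) : ℝ))⁻¹
    * (1 + ((3 * (l n : ℝ) - 4) / ((l n : ℝ) - 1)) * ((Ln l (n + 1) : ℝ) * s - 1))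

def IsPsiM (l : ℕ → ℕ) (PsiM : ℝ → ℝ) : Prop :=
  (∀ n : ℕ, ∀ s : ℝ, ((Ln l (n + 1) : ℝ))⁻¹ ≤ s → s ≤ ((Ln l n : ℝ))⁻¹ →
      PsiM s = psiMPiece l n s) ∧
  (∀ s : ℝ, 1 ≤ s → PsiM s = s ^ betaM l) ∧ PsiM 0 = 0

def psiRPiece (l : ℕ → ℕ) (n : ℕ) (s : ℝ) : ℝ :=
  Rn l (n + 1)
    * (1 + (((2 / 3) * (l n : ℝ) - 8 / 9) / ((l n : ℝ) - 1)) * ((Ln l (n + 1) : ℝ) * s - 1))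

def IsPsiR (l : ℕ → ℕ) (PsiR : ℝ → ℝ) : Prop :=
  (∀ n : ℕ, ∀ s : ℝ, ((Ln l (n + 1) : ℝ))⁻¹ ≤ s → s ≤ ((Ln l n : ℝ))⁻¹ →
      PsiR s = psiRPiece l n s) ∧
  (∀ s : ℝ, 1 ≤ s → PsiR s = s ^ betaR l) ∧ PsiR 0 = 0

/-- `μ` is the uniform distribution on `K`: a Borel measure carried by `K`
with `μ(K_w) = 1/M_{|w|}` for every word `w`. -/
def IsUnif (q : Fin 3 → E2) (l : ℕ → ℕ) (μ : Measure E2) : Prop :=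
  μ (Gasket q l)ᶜ = 0 ∧ ∀ n : ℕ, ∀ w ∈ Wn l n, μ (Cell q l n w) = ((Mn l n : ℝ≥0∞))⁻¹

/-- `μ` is the energy measure of `u`: a Borel measure carried by `K` with
`μ(K_w) = R_{|w|}⁻¹ E^{𝒍^{|w|}}(u∘F_w, u∘F_w)` for every word `w`. -/
def IsEnergyMeasure (q : Fin 3 → E2) (l : ℕ → ℕ) (u : E2 → ℝ) (μ : Measure E2) : Prop :=
  μ (Gasket q l)ᶜ = 0 ∧ ∀ n : ℕ, ∀ w ∈ Wn l n,
    μ (Cell q l n w) = ENNReal.ofReal ((Rn l n)⁻¹ *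
      EForm q (fun k => l (k + n)) (u ∘ wordMap q l w n) (u ∘ wordMap q l w n))




/-! ### Single level combinatorics -/

/-- Energy of a triangle with unit conductances. -/
def ec3 (x y z : ℝ) : ℝ := (x - y) ^ 2 + (x - z) ^ 2 + (y - z) ^ 2

/-- Energy of a lattice function on the upward triangle at `p`. -/
def ec (g : ℕ × ℕ → ℝ) (p : ℕ × ℕ) : ℝ := ec3 (g p) (g (p.1 + 1, p.2)) (g (p.1, p.2 + 1))

/-- Vertices of the upward triangle at `p`. -/
def IsV (p v : ℕ × ℕ) : Prop := v = p ∨ v = (p.1 + 1, p.2) ∨ v = (p.1, p.2 + 1)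

open Classical in
/-- The finset version of `Sset`. -/
def SF (l : ℕ) : Finset (ℕ × ℕ) :=
  ((Finset.range l) ×ˢ (Finset.range l)).filter (fun p => p ∈ Sset l)

lemma mem_SF {l : ℕ} (hl : 5 ≤ l) (p : ℕ × ℕ) : p ∈ SF l ↔ p ∈ Sset l := by
  unfold SF
  simp only [Finset.mem_filter, Finset.mem_product, Finset.mem_range, and_iff_right_iff_imp]
  rintro ⟨h, -⟩
  omega

lemma mem_SF_iff {l : ℕ} (hl : 5 ≤ l) (a b : ℕ) : (a, b) ∈ SF l ↔
    a + b ≤ l - 1 ∧ (a = 0 ∨ b = 0 ∨ a + b = l - 1) := by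
  rw [mem_SF hl]
  simp only [Sset, Set.mem_ofPred_eq, mul_eq_zero]
  constructor <;> rintro ⟨h1, h2⟩ <;> refine ⟨h1, ?_⟩ <;> omega

/-- The cyclic enumeration of the cells on the boundary. -/
def cyc (l p : ℕ) : ℕ × ℕ :=
  if p % (3 * (l - 1)) < l - 1 then (p % (3 * (l - 1)), 0)
  else if p % (3 * (l - 1)) < 2 * (l - 1) then
    (2 * (l - 1) - p % (3 * (l - 1)), p % (3 * (l - 1)) - (l - 1))
  else (0, 3 * (l - 1) - p % (3 * (l - 1)))

/-- The vertex shared by the cells `cyc l p` and `cyc l (p+1)`. -/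
def cycv (l p : ℕ) : ℕ × ℕ :=
  if p % (3 * (l - 1)) < l - 1 then (p % (3 * (l - 1)) + 1, 0)
  else if p % (3 * (l - 1)) < 2 * (l - 1) then
    (2 * (l - 1) - p % (3 * (l - 1)), p % (3 * (l - 1)) - (l - 1) + 1)
  else (0, 3 * (l - 1) - p % (3 * (l - 1)))

lemma cyc_mem {l : ℕ} (hl : 5 ≤ l) (p : ℕ) : cyc l p ∈ SF l := by
  have := Nat.mod_lt p (show 3 * (l - 1) > 0 by omega)
  unfold cyc
  split_ifs <;> rw [mem_SF_iff hl] <;> omega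

lemma cycv_left (l p : ℕ) : IsV (cyc l p) (cycv l p) := by
  unfold IsV cyc cycv
  split_ifs <;> simp

lemma cycv_right {l : ℕ} (hl : 5 ≤ l) (p : ℕ) : IsV (cyc l (p + 1)) (cycv l p) := by
  have h1 := Nat.mod_lt p (show 3 * (l - 1) > 0 by omega)
  have h2 : (p % (3 * (l - 1)) = 3 * (l - 1) - 1 ∧ (p + 1) % (3 * (l - 1)) = 0) ∨
      (p % (3 * (l - 1)) < 3 * (l - 1) - 1 ∧ (p + 1) % (3 * (l - 1)) = p % (3 * (l - 1)) + 1) := by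
    rw [Nat.add_mod, Nat.mod_eq_of_lt (show 1 < 3 * (l - 1) by omega)]
    by_cases h : p % (3 * (l - 1)) = 3 * (l - 1) - 1
    · left; rw [h]; rw [show 3 * (l - 1) - 1 + 1 = 3 * (l - 1) by omega, Nat.mod_self]; simp
    · right; exact ⟨by omega, Nat.mod_eq_of_lt (by omega)⟩
  unfold IsV cyc cycv
  generalize p % (3 * (l - 1)) = s at *
  generalize (p + 1) % (3 * (l - 1)) = s' at *
  split_ifs <;> simp only [Prod.mk.injEq, true_and, and_true] <;> omega

lemma cyc_inj {l : ℕ} (hl : 5 ≤ l) {p p' : ℕ} (h : cyc l p = cyc l p') :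
    p % (3 * (l - 1)) = p' % (3 * (l - 1)) := by
  have h1 := Nat.mod_lt p (show 3 * (l - 1) > 0 by omega)
  have h2 := Nat.mod_lt p' (show 3 * (l - 1) > 0 by omega)
  unfold cyc at h
  generalize p % (3 * (l - 1)) = s at *
  generalize p' % (3 * (l - 1)) = s' at *
  split_ifs at h <;> simp only [Prod.mk.injEq] at h <;> omega

lemma cyc_surj {l : ℕ} (hl : 5 ≤ l) {i : ℕ × ℕ} (hi : i ∈ SF l) :
    ∃ p, p < 3 * (l - 1) ∧ cyc l p = i := by
  obtain ⟨a, b⟩ := i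
  rw [mem_SF_iff hl] at hi
  by_cases hb : b = 0
  · refine ⟨a, by omega, ?_⟩
    unfold cyc
    rw [Nat.mod_eq_of_lt (by omega)]
    split_ifs <;> simp only [Prod.mk.injEq, true_and, and_true] <;> omega
  · by_cases ha : a = 0
    · refine ⟨3 * (l - 1) - b, by omega, ?_⟩
      unfold cyc
      rw [Nat.mod_eq_of_lt (by omega)]
      split_ifs <;> simp only [Prod.mk.injEq, true_and, and_true] <;> omega
    · refine ⟨(l - 1) + b, by omega, ?_⟩
      unfold cyc
      rw [Nat.mod_eq_of_lt (by omega)]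
      split_ifs <;> simp only [Prod.mk.injEq, true_and, and_true] <;> omega

lemma sum_SF_cyc {l : ℕ} (hl : 5 ≤ l) (F : ℕ × ℕ → ℝ) :
    ∑ i ∈ SF l, F i = ∑ p ∈ Finset.range (3 * (l - 1)), F (cyc l p) := by
  symm
  apply Finset.sum_bij (fun p _ => cyc l p)
  · intro p _; exact cyc_mem hl p
  · intro p hp p' hp' h
    have := cyc_inj hl h
    rw [Finset.mem_range] at hp hp'
    rwa [Nat.mod_eq_of_lt hp, Nat.mod_eq_of_lt hp'] at this
  · intro i hi
    obtain ⟨p, hp, h⟩ := cyc_surj hl hi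
    exact ⟨p, Finset.mem_range.2 hp, h⟩
  · intro p _; rfl

lemma sum_SF {k : ℕ} (F : ℕ × ℕ → ℝ) :
    ∑ i ∈ SF (k + 5), F i = ∑ p ∈ Finset.range (k + 4), F (p, 0)
      + ∑ p ∈ Finset.range (k + 4), F (k + 4 - p, p)
      + ∑ p ∈ Finset.range (k + 4), F (0, k + 4 - p) := by
  rw [sum_SF_cyc (by omega)]
  rw [show 3 * (k + 5 - 1) = (k + 4) + (k + 4) + (k + 4) by omega, Finset.sum_range_add,
    Finset.sum_range_add]
  congr 1
  · congr 1
    · apply Finset.sum_congr rfl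
      intro p hp
      rw [Finset.mem_range] at hp
      congr 1
      unfold cyc
      rw [Nat.mod_eq_of_lt (by omega)]
      split_ifs <;> simp only [Prod.mk.injEq, true_and, and_true] <;> omega
    · apply Finset.sum_congr rfl
      intro p hp
      rw [Finset.mem_range] at hp
      congr 1
      unfold cyc
      rw [Nat.mod_eq_of_lt (by omega)]
      split_ifs <;> simp only [Prod.mk.injEq, true_and, and_true] <;> omega
  · apply Finset.sum_congr rfl
    intro p hp
    rw [Finset.mem_range] at hp
    congr 1
    unfold cyc
    rw [Nat.mod_eq_of_lt (by omega)]
    split_ifs <;> simp only [Prod.mk.injEq, true_and, and_true] <;> omega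

lemma sum_split (k : ℕ) (f : ℕ → ℝ) : ∑ p ∈ Finset.range (k + 4), f p =
    f 0 + f 1 + ∑ p ∈ Finset.range (k + 1), f (p + 2) + f (k + 3) := by
  rw [show k + 4 = (k + 3) + 1 by omega, Finset.sum_range_succ, show k + 3 = k + 1 + 1 + 1 by omega,
    Finset.sum_range_succ', Finset.sum_range_succ']
  ring

lemma ec3_lower (x y z a b c : ℝ) (h : a + b + c = 0) :
    2 * (a * x + b * y + c * z) - (a ^ 2 + b ^ 2 + c ^ 2) / 3 ≤ ec3 x y z := by
  unfold ec3
  obtain rfl : c = -a - b := by linarith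
  nlinarith [sq_nonneg (2 * x - y - z - a), sq_nonneg (2 * y - x - z - b),
    sq_nonneg (2 * z - x - y - (-a - b))]

lemma ec3_nonneg (x y z : ℝ) : 0 ≤ ec3 x y z := by unfold ec3; positivity

lemma ec3_ge (x y z : ℝ) : (3 / 2) * (x - y) ^ 2 ≤ ec3 x y z := by
  unfold ec3; nlinarith [sq_nonneg (x + y - 2 * z)]

lemma ec3_swap (x y z : ℝ) : ec3 x y z = ec3 y x z := by unfold ec3; ring
lemma ec3_rot (x y z : ℝ) : ec3 x y z = ec3 y z x := by unfold ec3; ring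

lemma chain_lower (g E : ℕ → ℝ) (F : ℝ) (n : ℕ)
    (h : ∀ p < n, (3 / 2) * (g p - g (p + 1)) ^ 2 ≤ E p) :
    2 * F * (g 0 - g n) - (2 / 3) * n * F ^ 2 ≤ ∑ p ∈ Finset.range n, E p := by
  induction n with
  | zero => simp
  | succ n ih =>
    rw [Finset.sum_range_succ]
    have := ih (fun p hp => h p (by omega))
    have h2 := h n (by omega)
    push_cast
    nlinarith [sq_nonneg (3 / 2 * (g n - g (n + 1)) - F)]

lemma corner_lower (x00 x10 x01 x11 x20 x02 F G : ℝ) :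
    2 * ((F + G) * x00 - F * x20 - G * x02) - (5 / 9) * ((F + G) ^ 2 + F ^ 2 + G ^ 2) ≤
    ec3 x00 x10 x01 + ec3 x10 x20 x11 + ec3 x01 x11 x02 := by
  have h1 := ec3_lower x00 x10 x01 (F + G) (-(2 * F + G) / 3) (-(F + 2 * G) / 3) (by ring)
  have h2 := ec3_lower x10 x20 x11 ((2 * F + G) / 3) (-F) ((F - G) / 3) (by ring)
  have h3 := ec3_lower x01 x11 x02 ((F + 2 * G) / 3) ((G - F) / 3) (-G) (by ring)
  nlinarith

lemma rl_eq (k : ℕ) : rl (k + 5) = 9 / (6 * (k : ℝ) + 31) := by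
  unfold rl
  push_cast
  rw [inv_eq_one_div, div_eq_div_iff (by positivity) (by positivity)]
  ring

lemma rl_pos {l : ℕ} (hl : 5 ≤ l) : 0 < rl l := by unfold rl; positivity

set_option maxHeartbeats 1000000 in
/-- Trace inequality: the energy of the boundary values is at most the rescaled energy. -/
lemma trace_le {l : ℕ} (hl : 5 ≤ l) (g : ℕ × ℕ → ℝ) :
    rl l * ec3 (g (0, 0)) (g (l, 0)) (g (0, l)) ≤ ∑ i ∈ SF l, ec g i := by
  obtain ⟨k, rfl⟩ := Nat.exists_eq_add_of_le' hl
  rw [sum_SF, sum_split, sum_split, sum_split, rl_eq]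
  set r : ℝ := 9 / (6 * (k : ℝ) + 31) with hr
  have c0 := corner_lower (g (0, 0)) (g (1, 0)) (g (0, 1)) (g (1, 1)) (g (2, 0)) (g (0, 2))
    (r * ((g (0, 0)) - (g (k + 5, 0)))) (r * ((g (0, 0)) - (g (0, k + 5))))
  have c1 := corner_lower (g (k + 5, 0)) (g (k + 4, 1)) (g (k + 4, 0)) (g (k + 3, 1)) (g (k + 3, 2)) (g (k + 3, 0))
    (r * ((g (k + 5, 0)) - (g (0, k + 5)))) (r * ((g (k + 5, 0)) - (g (0, 0))))
  have c2 := corner_lower (g (0, k + 5)) (g (0, k + 4)) (g (1, k + 4)) (g (1, k + 3)) (g (0, k + 3)) (g (2, k + 3))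
    (r * ((g (0, k + 5)) - (g (0, 0)))) (r * ((g (0, k + 5)) - (g (k + 5, 0))))
  have s1 := chain_lower (fun p => g (p + 2, 0)) (fun p => ec g (p + 2, 0)) (r * ((g (0, 0)) - (g (k + 5, 0)))) (k + 1)
    (fun p _ => ec3_ge _ _ _)
  have s2 := chain_lower (fun p => g (k + 3 - p, p + 2)) (fun p => ec g (k + 4 - (p + 2), p + 2))
    (r * ((g (k + 5, 0)) - (g (0, k + 5)))) (k + 1) (by
      intro p hp
      simp only [ec]
      rw [show k + 4 - (p + 2) + 1 = k + 3 - p by omega, show k + 4 - (p + 2) = k + 3 - (p + 1) by omega,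
        show p + 2 + 1 = p + 1 + 2 by omega, ec3_rot]
      exact ec3_ge _ _ _)
  have s3 := chain_lower (fun p => g (0, k + 3 - p)) (fun p => ec g (0, k + 4 - (p + 2)))
    (r * ((g (0, k + 5)) - (g (0, 0)))) (k + 1) (by
      intro p hp
      simp only [ec]
      rw [show k + 4 - (p + 2) + 1 = k + 3 - p by omega, show k + 4 - (p + 2) = k + 3 - (p + 1) by omega,
        ec3_rot, ec3_rot]
      exact ec3_ge _ _ _)
  simp only [show k + 3 - (k + 1) = 2 by omega, show k + 1 + 2 = k + 3 by omega, zero_add, Nat.sub_zero]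
    at s1 s2 s3
  simp only [ec, show k + 4 - 1 = k + 3 by omega, show k + 4 - (k + 3) = 1 by omega, Nat.sub_zero,
    zero_add, one_add_one_eq_two, show k + 3 + 1 = k + 4 by omega,
    show k + 4 + 1 = k + 5 by omega, Nat.reduceSubDiff] at c0 c1 c2 s1 s2 s3 ⊢
  have hr2 : r * r * (6 * (k : ℝ) + 31) = 9 * r := by
    rw [hr]; field_simp
  have e1 : r * r * k * ec3 (g (0, 0)) (g (k + 5, 0)) (g (0, k + 5)) =
      (9 * r - 31 * r * r) / 6 * ec3 (g (0, 0)) (g (k + 5, 0)) (g (0, k + 5)) := by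
    rw [← hr2]; ring
  push_cast at s1 s2 s3
  clear_value r
  simp only [ec3] at *
  linarith [c0, c1, c2, s1, s2, s3, e1]



/-! ### Harmonic extension -/

/-- Values along a side from corner `A` to corner `A'`. -/
def sideV (k : ℕ) (A A' I I' F : ℝ) (p : ℕ) : ℝ :=
  if p = 0 then A else if p = 1 then A - I / 3 - (I + F) / 9
  else if p ≤ k + 3 then A - (5 / 9) * (I + F) - (2 / 3) * F * ((p : ℝ) - 2)
  else if p = k + 4 then A' - I' / 3 - (I' - F) / 9 else A'

/-- Values at the inner tips of the cells along a side. -/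
def tipV (k : ℕ) (A A' I I' F : ℝ) (p : ℕ) : ℝ :=
  if p = 1 then A - (2 / 3) * I else if p = k + 3 then A' - (2 / 3) * I'
  else (sideV k A A' I I' F p + sideV k A A' I I' F (p + 1)) / 2

lemma chain_ec (k : ℕ) (A A' I I' F : ℝ) (p : ℕ) (hp : p < k + 1) :
    ec3 (sideV k A A' I I' F (p + 2)) (sideV k A A' I I' F (p + 3)) (tipV k A A' I I' F (p + 2))
      = (2 / 3) * F ^ 2 := by
  have h1 : sideV k A A' I I' F (p + 2) = A - (5 / 9) * (I + F) - (2 / 3) * F * p := by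
    unfold sideV
    rw [if_neg (by omega), if_neg (by omega), if_pos (by omega)]
    push_cast; ring
  have h2 : sideV k A A' I I' F (p + 3) = A - (5 / 9) * (I + F) - (2 / 3) * F * (p + 1) := by
    unfold sideV
    rw [if_neg (by omega), if_neg (by omega), if_pos (by omega)]
    push_cast; ring
  have h3 : tipV k A A' I I' F (p + 2) = A - (5 / 9) * (I + F) - (2 / 3) * F * (p + 1 / 2) := by
    unfold tipV
    rw [if_neg (by omega), if_neg (by omega), h1, h2]
    ring
  rw [h1, h2, h3]
  unfold ec3
  ring

/-- The harmonic extension on the lattice points of the triangle of side `k+5`. -/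
def harmV (k : ℕ) (r a0 a1 a2 : ℝ) (v : ℕ × ℕ) : ℝ :=
  if v.2 = 0 then
    sideV k a0 a1 (r * (2 * a0 - a1 - a2)) (r * (2 * a1 - a0 - a2)) (r * (a0 - a1)) v.1
  else if v.1 = 0 then
    sideV k a2 a0 (r * (2 * a2 - a1 - a0)) (r * (2 * a0 - a1 - a2)) (r * (a2 - a0)) (k + 5 - v.2)
  else if v.1 + v.2 = k + 5 then
    sideV k a1 a2 (r * (2 * a1 - a0 - a2)) (r * (2 * a2 - a1 - a0)) (r * (a1 - a2)) v.2
  else if v.2 = 1 then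
    tipV k a0 a1 (r * (2 * a0 - a1 - a2)) (r * (2 * a1 - a0 - a2)) (r * (a0 - a1)) v.1
  else if v.1 = 1 then
    tipV k a2 a0 (r * (2 * a2 - a1 - a0)) (r * (2 * a0 - a1 - a2)) (r * (a2 - a0)) (k + 4 - v.2)
  else
    tipV k a1 a2 (r * (2 * a1 - a0 - a2)) (r * (2 * a2 - a1 - a0)) (r * (a1 - a2)) v.2

lemma sideV_0 (k : ℕ) (A A' I I' F : ℝ) : sideV k A A' I I' F 0 = A := by simp [sideV]
lemma sideV_1 (k : ℕ) (A A' I I' F : ℝ) : sideV k A A' I I' F 1 = A - I / 3 - (I + F) / 9 := by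
  simp [sideV]
lemma sideV_2 (k : ℕ) (A A' I I' F : ℝ) : sideV k A A' I I' F 2 = A - (5 / 9) * (I + F) := by
  simp [sideV]
lemma sideV_3 (k : ℕ) (A A' I I' F : ℝ) :
    sideV k A A' I I' F (k + 3) = A - (5 / 9) * (I + F) - (2 / 3) * F * (k + 1) := by
  unfold sideV
  rw [if_neg (by omega), if_neg (by omega), if_pos (by omega)]
  push_cast; ring
lemma sideV_4 (k : ℕ) (A A' I I' F : ℝ) :
    sideV k A A' I I' F (k + 4) = A' - I' / 3 - (I' - F) / 9 := by
  unfold sideV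
  rw [if_neg (by omega), if_neg (by omega), if_neg (by omega), if_pos (by omega)]
lemma sideV_5 (k : ℕ) (A A' I I' F : ℝ) : sideV k A A' I I' F (k + 5) = A' := by
  unfold sideV
  rw [if_neg (by omega), if_neg (by omega), if_neg (by omega), if_neg (by omega)]
lemma tipV_1 (k : ℕ) (A A' I I' F : ℝ) : tipV k A A' I I' F 1 = A - (2 / 3) * I := by
  simp [tipV]
lemma tipV_3 (k : ℕ) (A A' I I' F : ℝ) : tipV k A A' I I' F (k + 3) = A' - (2 / 3) * I' := by
  simp [tipV]

section
variable (k : ℕ) (r a0 a1 a2 : ℝ)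

lemma harm_b (p : ℕ) : harmV k r a0 a1 a2 (p, 0) =
    sideV k a0 a1 (r * (2 * a0 - a1 - a2)) (r * (2 * a1 - a0 - a2)) (r * (a0 - a1)) p := by
  simp [harmV]

lemma harm_l (j : ℕ) : harmV k r a0 a1 a2 (0, j) =
    sideV k a2 a0 (r * (2 * a2 - a1 - a0)) (r * (2 * a0 - a1 - a2)) (r * (a2 - a0)) (k + 5 - j) := by
  by_cases hj : j = 0
  · subst hj; rw [harm_b, sideV_0, Nat.sub_zero, sideV_5]
  · simp [harmV, hj]

lemma harm_h (j : ℕ) (hj : j ≤ k + 5) : harmV k r a0 a1 a2 (k + 5 - j, j) =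
    sideV k a1 a2 (r * (2 * a1 - a0 - a2)) (r * (2 * a2 - a1 - a0)) (r * (a1 - a2)) j := by
  by_cases h0 : j = 0
  · subst h0; rw [Nat.sub_zero, harm_b, sideV_0, sideV_5]
  · by_cases h5 : j = k + 5
    · subst h5; rw [Nat.sub_self, harm_l, Nat.sub_self, sideV_0, sideV_5]
    · unfold harmV
      dsimp only
      rw [if_neg (by omega), if_neg (by omega), if_pos (by omega)]

lemma harm_tb (p : ℕ) (h1 : 1 ≤ p) (h2 : p ≤ k + 3) : harmV k r a0 a1 a2 (p, 1) =
    tipV k a0 a1 (r * (2 * a0 - a1 - a2)) (r * (2 * a1 - a0 - a2)) (r * (a0 - a1)) p := by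
  unfold harmV
  dsimp only
  rw [if_neg (by omega), if_neg (by omega), if_neg (by omega), if_pos (by omega)]

lemma harm_tl (j : ℕ) (h1 : 1 ≤ j) (h2 : j ≤ k + 3) : harmV k r a0 a1 a2 (1, j) =
    tipV k a2 a0 (r * (2 * a2 - a1 - a0)) (r * (2 * a0 - a1 - a2)) (r * (a2 - a0)) (k + 4 - j) := by
  by_cases h : j = 1
  · subst h; rw [harm_tb _ _ _ _ _ _ le_rfl (by omega), tipV_1,
      show k + 4 - 1 = k + 3 by omega, tipV_3]
  unfold harmV
  dsimp only
  rw [if_neg (by omega), if_neg (by omega), if_neg (by omega), if_neg (by omega), if_pos (by omega)]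

lemma harm_th (j : ℕ) (h1 : 1 ≤ j) (h2 : j ≤ k + 3) : harmV k r a0 a1 a2 (k + 4 - j, j) =
    tipV k a1 a2 (r * (2 * a1 - a0 - a2)) (r * (2 * a2 - a1 - a0)) (r * (a1 - a2)) j := by
  by_cases h : j = 1
  · subst h; rw [show k + 4 - 1 = k + 3 by omega, harm_tb _ _ _ _ _ _ (by omega) (by omega), tipV_1,
      tipV_3]
  by_cases h' : j = k + 3
  · subst h'; rw [show k + 4 - (k + 3) = 1 by omega, harm_tl _ _ _ _ _ _ (by omega) (by omega),
      show k + 4 - (k + 3) = 1 by omega, tipV_1, tipV_3]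
  unfold harmV
  dsimp only
  rw [if_neg (by omega), if_neg (by omega), if_neg (by omega), if_neg (by omega), if_neg (by omega)]

end

/-- The harmonic extension with its scale. -/
def harm (l : ℕ) (a0 a1 a2 : ℝ) (v : ℕ × ℕ) : ℝ := harmV (l - 5) (rl l) a0 a1 a2 v

lemma harm_00 {l : ℕ} (hl : 5 ≤ l) (a0 a1 a2 : ℝ) : harm l a0 a1 a2 (0, 0) = a0 := by
  unfold harm; rw [harm_b, sideV_0]
lemma harm_10 {l : ℕ} (hl : 5 ≤ l) (a0 a1 a2 : ℝ) : harm l a0 a1 a2 (l, 0) = a1 := by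
  obtain ⟨k, rfl⟩ := Nat.exists_eq_add_of_le' hl
  unfold harm; rw [Nat.add_sub_cancel, harm_b, sideV_5]
lemma harm_01 {l : ℕ} (hl : 5 ≤ l) (a0 a1 a2 : ℝ) : harm l a0 a1 a2 (0, l) = a2 := by
  obtain ⟨k, rfl⟩ := Nat.exists_eq_add_of_le' hl
  unfold harm; rw [Nat.add_sub_cancel, harm_l, Nat.sub_self, sideV_0]

set_option maxHeartbeats 1000000 in
lemma harm_energy {l : ℕ} (hl : 5 ≤ l) (a0 a1 a2 : ℝ) :
    ∑ i ∈ SF l, ec (harm l a0 a1 a2) i = rl l * ec3 a0 a1 a2 := by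
  obtain ⟨k, rfl⟩ := Nat.exists_eq_add_of_le' hl
  have hh : harm (k + 5) a0 a1 a2 = harmV k (rl (k + 5)) a0 a1 a2 := by
    funext v; unfold harm; rw [Nat.add_sub_cancel]
  rw [hh, sum_SF, sum_split, sum_split, sum_split]
  have hr2 : rl (k + 5) * (6 * (k : ℝ) + 31) = 9 := by
    rw [rl_eq]; field_simp
  generalize rl (k + 5) = r at *
  have s1 : ∑ p ∈ Finset.range (k + 1), ec (harmV k r a0 a1 a2) (p + 2, 0) =
      (k + 1) * ((2 / 3) * (r * (a0 - a1)) ^ 2) := by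
    rw [Finset.sum_congr rfl (g := fun _ => (2 / 3) * (r * (a0 - a1)) ^ 2)]
    · rw [Finset.sum_const, Finset.card_range, nsmul_eq_mul]; push_cast; ring
    · intro p hp
      rw [Finset.mem_range] at hp
      simp only [ec]
      rw [harm_b, harm_b, zero_add, harm_tb _ _ _ _ _ _ (by omega) (by omega)]
      exact chain_ec _ _ _ _ _ _ _ hp
  have s2 : ∑ p ∈ Finset.range (k + 1), ec (harmV k r a0 a1 a2) (k + 4 - (p + 2), p + 2) =
      (k + 1) * ((2 / 3) * (r * (a1 - a2)) ^ 2) := by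
    rw [Finset.sum_congr rfl (g := fun _ => (2 / 3) * (r * (a1 - a2)) ^ 2)]
    · rw [Finset.sum_const, Finset.card_range, nsmul_eq_mul]; push_cast; ring
    · intro p hp
      rw [Finset.mem_range] at hp
      simp only [ec]
      rw [harm_th _ _ _ _ _ _ (by omega) (by omega), show k + 4 - (p + 2) + 1 = k + 5 - (p + 2) by omega,
        harm_h _ _ _ _ _ _ (by omega), show k + 4 - (p + 2) = k + 5 - (p + 2 + 1) by omega,
        harm_h _ _ _ _ _ _ (by omega), ec3_rot]
      exact chain_ec _ _ _ _ _ _ _ hp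
  have s3 : ∑ p ∈ Finset.range (k + 1), ec (harmV k r a0 a1 a2) (0, k + 4 - (p + 2)) =
      (k + 1) * ((2 / 3) * (r * (a2 - a0)) ^ 2) := by
    rw [Finset.sum_congr rfl (g := fun _ => (2 / 3) * (r * (a2 - a0)) ^ 2)]
    · rw [Finset.sum_const, Finset.card_range, nsmul_eq_mul]; push_cast; ring
    · intro p hp
      rw [Finset.mem_range] at hp
      simp only [ec]
      rw [zero_add, harm_l, harm_l, harm_tl _ _ _ _ _ _ (by omega) (by omega),
        show k + 5 - (k + 4 - (p + 2)) = p + 3 by omega,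
        show k + 5 - (k + 4 - (p + 2) + 1) = p + 2 by omega,
        show k + 4 - (k + 4 - (p + 2)) = p + 2 by omega, ec3_rot, ec3_rot]
      exact chain_ec _ _ _ _ _ _ _ hp
  rw [s1, s2, s3]
  have t11 : harmV k r a0 a1 a2 (1, 1) = a0 - (2 / 3) * (r * (2 * a0 - a1 - a2)) := by
    rw [harm_tb _ _ _ _ _ _ (by omega) (by omega), tipV_1]
  have t31 : harmV k r a0 a1 a2 (k + 3, 1) = a1 - (2 / 3) * (r * (2 * a1 - a0 - a2)) := by
    rw [harm_tb _ _ _ _ _ _ (by omega) (by omega), tipV_3]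
  have t13 : harmV k r a0 a1 a2 (1, k + 3) = a2 - (2 / 3) * (r * (2 * a2 - a1 - a0)) := by
    rw [harm_tl _ _ _ _ _ _ (by omega) (by omega), show k + 4 - (k + 3) = 1 by omega, tipV_1]
  have l1 : harmV k r a0 a1 a2 (0, 1) = _ := harm_l k r a0 a1 a2 1
  have l2 : harmV k r a0 a1 a2 (0, 2) = _ := harm_l k r a0 a1 a2 2
  have l3 : harmV k r a0 a1 a2 (0, k + 3) = _ := harm_l k r a0 a1 a2 (k + 3)
  have l4 : harmV k r a0 a1 a2 (0, k + 4) = _ := harm_l k r a0 a1 a2 (k + 4)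
  have l5 : harmV k r a0 a1 a2 (0, k + 5) = _ := harm_l k r a0 a1 a2 (k + 5)
  have h1 := harm_h k r a0 a1 a2 1 (by omega)
  have h2 := harm_h k r a0 a1 a2 2 (by omega)
  have h3 := harm_h k r a0 a1 a2 (k + 3) (by omega)
  have h4 := harm_h k r a0 a1 a2 (k + 4) (by omega)
  rw [show k + 5 - 1 = k + 4 by omega, sideV_4] at l1
  rw [show k + 5 - 2 = k + 3 by omega, sideV_3] at l2
  rw [show k + 5 - (k + 3) = 2 by omega, sideV_2] at l3
  rw [show k + 5 - (k + 4) = 1 by omega, sideV_1] at l4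
  rw [show k + 5 - (k + 5) = 0 by omega, sideV_0] at l5
  rw [show k + 5 - 1 = k + 4 by omega, sideV_1] at h1
  rw [show k + 5 - 2 = k + 3 by omega, sideV_2] at h2
  rw [show k + 5 - (k + 3) = 2 by omega, sideV_3] at h3
  rw [show k + 5 - (k + 4) = 1 by omega, sideV_4] at h4
  simp only [ec, show k + 4 - 1 = k + 3 by omega, show k + 4 - (k + 3) = 1 by omega, Nat.sub_zero,
    zero_add, one_add_one_eq_two, show k + 3 + 1 = k + 4 by omega,
    show k + 4 + 1 = k + 5 by omega]
  rw [t11, t31, t13, l1, l2, l3, l4, l5, h1, h2, h3, h4]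
  simp only [harm_b, sideV_0, sideV_1, sideV_2, sideV_3, sideV_4, sideV_5]
  have hk : r * k = (9 - 31 * r) / 6 := by linarith
  have hk2 : ∀ x : ℝ, 2 / 3 * (r * x) * ((k : ℝ) + 1) = 2 / 3 * x * ((9 - 25 * r) / 6) := by
    intro x
    linear_combination (2 / 3) * x * hk
  have hk3 : ∀ x : ℝ, ((k : ℝ) + 1) * (2 / 3 * (r * x) ^ 2) = 2 / 3 * x ^ 2 * r * ((9 - 25 * r) / 6) := by
    intro x
    linear_combination (2 / 3) * x ^ 2 * r * hk
  simp only [hk2, hk3, ec3]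
  ring



/-! ### Paths of cells around the boundary -/

lemma cyc_congr {l p p' : ℕ} (h : p % (3 * (l - 1)) = p' % (3 * (l - 1))) : cyc l p = cyc l p' := by
  unfold cyc; rw [h]

lemma eq_of_mod_eq {M a b : ℕ} (hab : a ≤ b) (hlt : b - a < M) (h : a % M = b % M) : a = b := by
  have h1 : M ∣ b - a := (Nat.modEq_iff_dvd' hab).1 h
  have := Nat.eq_zero_of_dvd_of_lt h1 hlt
  omega

lemma corner_pos {l : ℕ} (hl : 5 ≤ l) {κ : ℕ × ℕ} (hκ : κ = (0, 0) ∨ κ = (l, 0) ∨ κ = (0, l)) :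
    ∃ P, 3 * (l - 1) ≤ P ∧ P < 2 * (3 * (l - 1)) ∧ IsV (cyc l P) κ := by
  rcases hκ with rfl | rfl | rfl
  · refine ⟨3 * (l - 1), le_rfl, by omega, ?_⟩
    unfold cyc IsV
    rw [Nat.mod_self]
    split_ifs
    · simp
    · omega
    · omega
  · refine ⟨3 * (l - 1) + (l - 1), by omega, by omega, ?_⟩
    unfold cyc IsV
    rw [Nat.add_mod_left, Nat.mod_eq_of_lt (by omega)]
    split_ifs
    · omega
    · simp only [Prod.mk.injEq]; omega
    · omega
  · refine ⟨3 * (l - 1) + 2 * (l - 1), by omega, by omega, ?_⟩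
    unfold cyc IsV
    rw [Nat.add_mod_left, Nat.mod_eq_of_lt (by omega)]
    split_ifs
    · omega
    · omega
    · simp only [Prod.mk.injEq, true_and]; omega

lemma path_exists {l : ℕ} (hl : 5 ≤ l) {i κ : ℕ × ℕ} (hi : i ∈ SF l)
    (hκ : κ = (0, 0) ∨ κ = (l, 0) ∨ κ = (0, l)) :
    ∃ (N : ℕ) (c v : ℕ → ℕ × ℕ), 2 * N ≤ 3 * (l - 1) ∧ v 0 = κ ∧ IsV i (v N) ∧
      (∀ t < N, c t ∈ SF l ∧ c t ≠ i ∧ IsV (c t) (v t) ∧ IsV (c t) (v (t + 1))) ∧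
      (∀ t < N, ∀ t' < N, c t = c t' → t = t') := by
  obtain ⟨P, hP1, hP2, hPv⟩ := corner_pos hl hκ
  obtain ⟨m, hm, rfl⟩ := cyc_surj hl hi
  set M := 3 * (l - 1) with hM
  have hMpos : 0 < M := by omega
  have key : (P + (m + 2 * M - P) % M) % M = m % M := by
    rw [Nat.add_mod_mod, show P + (m + 2 * M - P) = m + 2 * M by omega, Nat.add_mul_mod_self_right]
  have hN1 : (m + 2 * M - P) % M < M := Nat.mod_lt _ hMpos
  generalize (m + 2 * M - P) % M = N1 at *
  by_cases h : 2 * N1 ≤ M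
  · refine ⟨N1, fun t => cyc l (P + t), fun t => if t = 0 then κ else cycv l (P + t - 1), h, by simp,
      ?_, ?_, ?_⟩
    · by_cases h0 : N1 = 0
      · subst h0
        simp only [if_true]
        rw [← cyc_congr (p := P) (p' := m) (by simpa using key)]
        exact hPv
      · beta_reduce
        rw [if_neg h0, ← cyc_congr (p := P + N1) (p' := m) key]
        have := cycv_right hl (P + N1 - 1)
        rwa [show P + N1 - 1 + 1 = P + N1 by omega] at this
    · intro t ht
      refine ⟨cyc_mem hl _, ?_, ?_, ?_⟩
      · intro h1
        have h2 := cyc_inj hl h1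
        rw [← hM, ← key] at h2
        have := eq_of_mod_eq (by omega) (by omega) h2
        omega
      · by_cases h0 : t = 0
        · subst h0; simpa using hPv
        · simp only
          rw [if_neg h0]
          have := cycv_right hl (P + t - 1)
          rwa [show P + t - 1 + 1 = P + t by omega] at this
      · simp only
        rw [if_neg (by omega), show P + (t + 1) - 1 = P + t by omega]
        exact cycv_left _ _
    · intro t ht t' ht' h1
      have h2 := cyc_inj hl h1
      rw [← hM] at h2
      rcases le_total t t' with h3 | h3
      · have := eq_of_mod_eq (by omega) (by omega) h2
        omega
      · have := eq_of_mod_eq (by omega) (by omega) h2.symm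
        omega
  · have key2 : (P - (M - N1)) % M = m % M := by
      rw [← key, show P + N1 = P - (M - N1) + M by omega, Nat.add_mod_right]
    refine ⟨M - N1, fun t => cyc l (P - t), fun t => if t = 0 then κ else cycv l (P - t), by omega,
      by simp, ?_, ?_, ?_⟩
    · beta_reduce
      rw [if_neg (by omega), ← cyc_congr (p := P - (M - N1)) (p' := m) key2]
      exact cycv_left _ _
    · intro t ht
      refine ⟨cyc_mem hl _, ?_, ?_, ?_⟩
      · intro h1
        have h2 := cyc_inj hl h1
        rw [← hM, ← key2] at h2
        have := eq_of_mod_eq (by omega) (by omega) h2.symm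
        omega
      · by_cases h0 : t = 0
        · subst h0; simpa using hPv
        · simp only
          rw [if_neg h0]
          exact cycv_left _ _
      · simp only
        rw [if_neg (by omega)]
        have := cycv_right hl (P - (t + 1))
        rwa [show P - (t + 1) + 1 = P - t by omega] at this
    · intro t ht t' ht' h1
      have h2 := cyc_inj hl h1
      rw [← hM] at h2
      rcases le_total t t' with h3 | h3
      · have := eq_of_mod_eq (by omega) (by omega) h2.symm
        omega
      · have := eq_of_mod_eq (by omega) (by omega) h2
        omega

lemma ec_vert (g : ℕ × ℕ → ℝ) {p v v' : ℕ × ℕ} (h : IsV p v) (h' : IsV p v') :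
    (3 / 2) * (g v - g v') ^ 2 ≤ ec g p := by
  unfold ec
  have a1 := ec3_ge (g p) (g (p.1 + 1, p.2)) (g (p.1, p.2 + 1))
  have a2 := ec3_ge (g (p.1 + 1, p.2)) (g (p.1, p.2 + 1)) (g p)
  have a3 := ec3_ge (g (p.1, p.2 + 1)) (g p) (g (p.1 + 1, p.2))
  rw [← ec3_rot] at a2
  rw [← ec3_rot, ← ec3_rot] at a3
  have a0 := ec3_nonneg (g p) (g (p.1 + 1, p.2)) (g (p.1, p.2 + 1))
  rcases h with rfl | rfl | rfl <;> rcases h' with rfl | rfl | rfl <;> nlinarith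

lemma energy_step {l : ℕ} (hl : 5 ≤ l) (g e : ℕ × ℕ → ℝ) (he : ∀ i ∈ SF l, ec g i ≤ e i)
    (ξ : ℝ) {i κ : ℕ × ℕ} (hi : i ∈ SF l) (hξ : ∀ v, IsV i v → (ξ - g v) ^ 2 ≤ 2 * e i)
    (hκ : κ = (0, 0) ∨ κ = (l, 0) ∨ κ = (0, l)) :
    (ξ - g κ) ^ 2 ≤ 2 * ((rl l)⁻¹ * ∑ i ∈ SF l, e i) := by
  obtain ⟨N, c, v, hN, hv0, hvN, hc, hinj⟩ := path_exists hl hi hκ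
  have hch : ∀ F : ℝ, 2 * F * (g (v 0) - g (v N)) - (2 / 3) * N * F ^ 2 ≤
      ∑ t ∈ Finset.range N, e (c t) := fun F =>
    chain_lower (fun t => g (v t)) (fun t => e (c t)) F N
      (fun t ht => (ec_vert g (hc t ht).2.2.1 (hc t ht).2.2.2).trans (he _ (hc t ht).1))
  have hnn : ∀ i ∈ SF l, 0 ≤ e i := fun i hi => (ec3_nonneg _ _ _).trans (he i hi)
  have hsum : e i + ∑ t ∈ Finset.range N, e (c t) ≤ ∑ i ∈ SF l, e i := by
    have h1 : ∑ t ∈ Finset.range N, e (c t) = ∑ j ∈ (Finset.range N).image c, e j := by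
      rw [Finset.sum_image]
      intro t ht t' ht' h
      exact hinj t (Finset.mem_range.1 ht) t' (Finset.mem_range.1 ht') h
    have hni : i ∉ (Finset.range N).image c := by
      rw [Finset.mem_image]
      rintro ⟨t, ht, h⟩
      exact (hc t (Finset.mem_range.1 ht)).2.1 h
    rw [h1, ← Finset.sum_insert hni]
    apply Finset.sum_le_sum_of_subset_of_nonneg
    · intro j hj
      rw [Finset.mem_insert, Finset.mem_image] at hj
      rcases hj with rfl | ⟨t, ht, rfl⟩
      · exact hi
      · exact (hc t (Finset.mem_range.1 ht)).1
    · intro j hj _; exact hnn j hj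
  have h3 := hξ _ hvN
  rw [hv0] at hch
  set S := ∑ t ∈ Finset.range N, e (c t)
  set D := g κ - g (v N)
  set A := ξ - g (v N)
  have hA : ξ - g κ = A - D := by ring
  rw [hA]
  have hNl : (2 : ℝ) * N ≤ 3 * (l - 1) := by
    have : (2 * N : ℕ) + 3 ≤ 3 * l := by omega
    have : ((2 * N + 3 : ℕ) : ℝ) ≤ ((3 * l : ℕ) : ℝ) := by exact_mod_cast this
    push_cast at this
    linarith
  have hl5 : (5 : ℝ) ≤ l := by exact_mod_cast hl
  have hei := hnn i hi
  -- with `F = D - A` weight `w`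
  have hB : (0 : ℝ) < 2 + (2 / 3) * N := by positivity
  have hmain : (A - D) ^ 2 ≤ (2 + (2 / 3) * N) * (e i + S) := by
    have hF := hch ((D - A) / (2 + (2 / 3) * N))
    set y := (D - A) / (2 + (2 / 3) * N) with hy
    have hy2 : D - A = y * (2 + (2 / 3) * N) := by rw [hy]; field_simp
    have h4 : 2 * y * (-A) - 2 * y ^ 2 ≤ e i := by nlinarith [sq_nonneg (A + 2 * y)]
    have h5 : y ^ 2 * (2 + (2 / 3) * N) ≤ e i + S := by
      have h6 : 2 * y * (D - A) = 2 * y * (y * (2 + (2 / 3) * N)) := by rw [← hy2]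
      linarith
    calc (A - D) ^ 2 = (2 + (2 / 3) * N) * (y ^ 2 * (2 + (2 / 3) * N)) := by
          rw [show (A - D) ^ 2 = (D - A) ^ 2 by ring, hy2]; ring
      _ ≤ _ := by gcongr
  have hT : 0 ≤ ∑ i ∈ SF l, e i := Finset.sum_nonneg hnn
  calc (A - D) ^ 2 ≤ (2 + (2 / 3) * N) * (e i + S) := hmain
    _ ≤ (2 + (2 / 3) * N) * ∑ i ∈ SF l, e i := by gcongr
    _ ≤ (2 * (2 * (l : ℝ) / 3 + 1 / 9)) * ∑ i ∈ SF l, e i := by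
        gcongr; linarith
    _ = _ := by unfold rl; rw [inv_inv]; ring



/-! ### The hierarchy of cells -/

/-- Lower left corner of the `i`-th child of the cell at `p`. -/
def child (m : ℕ) (p i : ℕ × ℕ) : ℕ × ℕ := (m * p.1 + i.1, m * p.2 + i.2)

/-- Positions of the cells of level `n`. -/
def PF (l : ℕ → ℕ) : ℕ → Finset (ℕ × ℕ)
  | 0 => {(0, 0)}
  | n + 1 => ((PF l n) ×ˢ SF (l n)).image (fun x => child (l n) x.1 x.2)

lemma mem_PF_succ {l : ℕ → ℕ} {n : ℕ} {p' : ℕ × ℕ} : p' ∈ PF l (n + 1) ↔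
    ∃ p ∈ PF l n, ∃ i ∈ SF (l n), child (l n) p i = p' := by
  simp only [PF, Finset.mem_image, Finset.mem_product, Prod.exists]
  constructor
  · rintro ⟨a, b, c, d, ⟨h1, h2⟩, h3⟩
    exact ⟨a, b, h1, c, d, h2, h3⟩
  · rintro ⟨a, b, h1, c, d, h2, h3⟩
    exact ⟨a, b, c, d, ⟨h1, h2⟩, h3⟩

lemma SF_lt {l : ℕ} (hl : 5 ≤ l) {i : ℕ × ℕ} (hi : i ∈ SF l) :
    i.1 + i.2 < l ∧ i.1 < l ∧ i.2 < l := by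
  obtain ⟨a, b⟩ := i
  rw [mem_SF_iff hl] at hi
  simp only
  omega

lemma digit_eq {m P P' i i' : ℕ} (hi : i < m) (hi' : i' < m) (h : m * P + i = m * P' + i') :
    P = P' ∧ i = i' := by
  have h1 : (m * P + i) / m = P := by
    rw [Nat.mul_add_div (by omega), Nat.div_eq_of_lt hi, add_zero]
  have h2 : (m * P' + i') / m = P' := by
    rw [Nat.mul_add_div (by omega), Nat.div_eq_of_lt hi', add_zero]
  have h3 : P = P' := by rw [← h1, ← h2, h]
  subst h3
  omega

lemma digit_succ {m P P' i i' : ℕ} (hi : i < m) (hi' : i' < m) (h : m * P + i = m * P' + i' + 1) :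
    (P = P' ∧ i = i' + 1) ∨ (P = P' + 1 ∧ i = 0 ∧ i' + 1 = m) := by
  by_cases h1 : i' + 1 < m
  · left
    exact digit_eq hi h1 (by omega)
  · right
    have h2 : m * P + i = m * (P' + 1) + 0 := by rw [mul_add]; omega
    have := digit_eq hi (by omega) h2
    exact ⟨this.1, this.2, by omega⟩

lemma child_inj {m : ℕ} {p p' i i' : ℕ × ℕ} (h1 : i.1 < m) (h2 : i.2 < m) (h1' : i'.1 < m)
    (h2' : i'.2 < m) (h : child m p i = child m p' i') : p = p' ∧ i = i' := by
  unfold child at h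
  rw [Prod.mk.injEq] at h
  have a := digit_eq h1 h1' h.1
  have b := digit_eq h2 h2' h.2
  exact ⟨Prod.ext a.1 b.1, Prod.ext a.2 b.2⟩

section
variable {l : ℕ → ℕ} (hl : ∀ n, 5 ≤ l n)
include hl

lemma sum_PF_succ (n : ℕ) (F : ℕ × ℕ → ℝ) :
    ∑ p ∈ PF l (n + 1), F p = ∑ p ∈ PF l n, ∑ i ∈ SF (l n), F (child (l n) p i) := by
  rw [← Finset.sum_product', PF, Finset.sum_image]
  rintro ⟨p, i⟩ h ⟨p', i'⟩ h' he
  simp only [Finset.coe_product, Set.mem_prod, Finset.mem_coe] at h h'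
  have a := SF_lt (hl n) h.2
  have b := SF_lt (hl n) h'.2
  have := child_inj a.2.1 a.2.2 b.2.1 b.2.2 he
  exact Prod.ext this.1 this.2

lemma no3_core (n : ℕ) : ∀ a b : ℕ, (a + 1, b + 1) ∈ PF l n → (a, b + 1) ∈ PF l n →
    (a + 1, b) ∈ PF l n → False := by
  induction n with
  | zero => intro a b h; simp [PF] at h
  | succ n ih =>
    intro a b h1 h2 h3
    obtain ⟨⟨p1, p2⟩, hp, ⟨i1, i2⟩, hi, hc⟩ := mem_PF_succ.1 h1
    obtain ⟨⟨p1', p2'⟩, hp', ⟨i1', i2'⟩, hi', hc'⟩ := mem_PF_succ.1 h2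
    obtain ⟨⟨p1'', p2''⟩, hp'', ⟨i1'', i2''⟩, hi'', hc''⟩ := mem_PF_succ.1 h3
    unfold child at hc hc' hc''
    rw [Prod.mk.injEq] at hc hc' hc''
    simp only at hc hc' hc''
    have m5 := hl n
    rw [mem_SF_iff m5] at hi hi' hi''
    have a1 := digit_succ (m := l n) (P := p1) (P' := p1') (i := i1) (i' := i1')
      (by omega) (by omega) (by omega)
    have a2 := digit_eq (m := l n) (P := p2) (P' := p2') (i := i2) (i' := i2')
      (by omega) (by omega) (by omega)
    have b1 := digit_eq (m := l n) (P := p1) (P' := p1'') (i := i1) (i' := i1'')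
      (by omega) (by omega) (by omega)
    have b2 := digit_succ (m := l n) (P := p2) (P' := p2'') (i := i2) (i' := i2'')
      (by omega) (by omega) (by omega)
    obtain ⟨rfl, rfl⟩ := a2
    obtain ⟨rfl, rfl⟩ := b1
    rcases a1 with ⟨rfl, a1⟩ | ⟨rfl, a1⟩ <;> rcases b2 with ⟨rfl, b2⟩ | ⟨rfl, b2⟩
    · omega
    · omega
    · omega
    · exact ih p1' p2'' hp hp' hp''

lemma no3 (n : ℕ) {p1 p2 p3 v : ℕ × ℕ} (h1 : p1 ∈ PF l n) (h2 : p2 ∈ PF l n) (h3 : p3 ∈ PF l n)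
    (v1 : IsV p1 v) (v2 : IsV p2 v) (v3 : IsV p3 v) : p1 = p2 ∨ p1 = p3 ∨ p2 = p3 := by
  obtain ⟨a1, b1⟩ := p1
  obtain ⟨a2, b2⟩ := p2
  obtain ⟨a3, b3⟩ := p3
  obtain ⟨a, b⟩ := v
  unfold IsV at v1 v2 v3
  simp only [Prod.mk.injEq] at v1 v2 v3 ⊢
  by_contra hcon
  have hab : 1 ≤ a ∧ 1 ≤ b := by omega
  obtain ⟨a, rfl⟩ := Nat.exists_eq_add_of_le' hab.1
  obtain ⟨b, rfl⟩ := Nat.exists_eq_add_of_le' hab.2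
  have key : (a + 1, b + 1) ∈ PF l n ∧ (a, b + 1) ∈ PF l n ∧ (a + 1, b) ∈ PF l n := by
    refine ⟨?_, ?_, ?_⟩
    · have : (a1 = a + 1 ∧ b1 = b + 1) ∨ (a2 = a + 1 ∧ b2 = b + 1) ∨ (a3 = a + 1 ∧ b3 = b + 1) := by
        omega
      rcases this with ⟨rfl, rfl⟩ | ⟨rfl, rfl⟩ | ⟨rfl, rfl⟩ <;> assumption
    · have : (a1 = a ∧ b1 = b + 1) ∨ (a2 = a ∧ b2 = b + 1) ∨ (a3 = a ∧ b3 = b + 1) := by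
        omega
      rcases this with ⟨rfl, rfl⟩ | ⟨rfl, rfl⟩ | ⟨rfl, rfl⟩ <;> assumption
    · have : (a1 = a + 1 ∧ b1 = b) ∨ (a2 = a + 1 ∧ b2 = b) ∨ (a3 = a + 1 ∧ b3 = b) := by
        omega
      rcases this with ⟨rfl, rfl⟩ | ⟨rfl, rfl⟩ | ⟨rfl, rfl⟩ <;> assumption
  exact no3_core hl n a b key.1 key.2.1 key.2.2

open Classical in
lemma indicator_energy (n : ℕ) {p : ℕ × ℕ} (hp : p ∈ PF l n) :
    ∑ p' ∈ PF l n, ec (fun v => if IsV p v then (1 : ℝ) else 0) p' ≤ 6 := by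
  set g : ℕ × ℕ → ℝ := fun v => if IsV p v then (1 : ℝ) else 0 with hg
  have hle : ∀ p', ec g p' ≤ 2 := by
    intro p'
    unfold ec ec3
    simp only [hg]
    split_ifs <;> norm_num
  set T := (PF l n).filter (fun p' => ec g p' ≠ 0) with hT
  have h1 : ∑ p' ∈ PF l n, ec g p' = ∑ p' ∈ T, ec g p' := by
    rw [hT, Finset.sum_filter_ne_zero]
  have hex : ∀ p' : ℕ × ℕ, ∃ v, p' ∈ T → (IsV p v ∧ IsV p' v) := by
    intro p'
    by_contra hcon
    push Not at hcon
    have hmem := (hcon p').1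
    have hv : ∀ v, IsV p' v → ¬ IsV p v := fun v h h' => (hcon v).2 h' h
    rw [hT, Finset.mem_filter] at hmem
    apply hmem.2
    unfold ec ec3
    simp only [hg]
    rw [if_neg (hv _ (Or.inl rfl)), if_neg (hv _ (Or.inr (Or.inl rfl))),
      if_neg (hv _ (Or.inr (Or.inr rfl)))]
    norm_num
  choose f hf using hex
  have hpT : ∀ p' ∈ T, p' ≠ p := by
    rintro p' h rfl
    rw [hT, Finset.mem_filter] at h
    apply h.2
    unfold ec ec3
    simp only [hg]
    rw [if_pos (show IsV p' p' from Or.inl rfl),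
      if_pos (show IsV p' (p'.1 + 1, p'.2) from Or.inr (Or.inl rfl)),
      if_pos (show IsV p' (p'.1, p'.2 + 1) from Or.inr (Or.inr rfl))]
    norm_num
  have hcard : T.card ≤ 3 := by
    have h2 : T.card ≤ ({p, (p.1 + 1, p.2), (p.1, p.2 + 1)} : Finset (ℕ × ℕ)).card := by
      apply Finset.card_le_card_of_injOn f
      · intro p' h'
        have := (hf p' h').1
        unfold IsV at this
        simpa using this
      · intro p1 h1 p2 h2 h12
        rw [Finset.mem_coe] at h1 h2
        have m1 := (Finset.mem_filter.1 (hT ▸ h1)).1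
        have m2 := (Finset.mem_filter.1 (hT ▸ h2)).1
        have := no3 hl n m1 m2 hp (hf p1 h1).2 (h12 ▸ (hf p2 h2).2) (hf p1 h1).1
        rcases this with h | h | h
        · exact h
        · exact absurd h (hpT _ h1)
        · exact absurd h (hpT _ h2)
    exact h2.trans Finset.card_le_three
  rw [h1]
  calc ∑ p' ∈ T, ec g p' ≤ ∑ p' ∈ T, (2 : ℝ) := Finset.sum_le_sum fun i _ => hle i
    _ = 2 * T.card := by rw [Finset.sum_const, nsmul_eq_mul]; ring
    _ ≤ 2 * 3 := by gcongr; exact_mod_cast hcard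
    _ = 6 := by norm_num

end

lemma Rn_succ (l : ℕ → ℕ) (n : ℕ) : Rn l (n + 1) = Rn l n * rl (l n) := by
  unfold Rn; rw [Finset.prod_range_succ]

lemma Rn_pos {l : ℕ → ℕ} (hl : ∀ n, 5 ≤ l n) (n : ℕ) : 0 < Rn l n :=
  Finset.prod_pos fun k _ => rl_pos (hl k)

/-- Compatibility of a family of lattice functions. -/
def Compat (l : ℕ → ℕ) (U : ℕ → ℕ × ℕ → ℝ) : Prop :=
  ∀ n a b, U (n + 1) (l n * a, l n * b) = U n (a, b)

/-- Level `n` energy. -/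
def EL (l : ℕ → ℕ) (U : ℕ → ℕ × ℕ → ℝ) (n : ℕ) : ℝ := (Rn l n)⁻¹ * ∑ p ∈ PF l n, ec (U n) p

/-- Energy inside of a cell, measured `k` levels below. -/
def Eloc (l : ℕ → ℕ) (U : ℕ → ℕ × ℕ → ℝ) : ℕ → ℕ → ℕ × ℕ → ℝ
  | 0, n, p => ec (U n) p
  | k + 1, n, p => (rl (l n))⁻¹ * ∑ i ∈ SF (l n), Eloc l U k (n + 1) (child (l n) p i)

/-- `x` is a lattice vertex of level `n + k` inside of the cell `p` of level `n`. -/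
def Desc (l : ℕ → ℕ) : ℕ → ℕ → ℕ × ℕ → ℕ × ℕ → Prop
  | 0, _, p, x => IsV p x
  | k + 1, n, p, x => ∃ i ∈ SF (l n), Desc l k (n + 1) (child (l n) p i) x

section
variable {l : ℕ → ℕ} (hl : ∀ n, 5 ≤ l n) {U : ℕ → ℕ × ℕ → ℝ}
include hl

lemma sum_Eloc (k : ℕ) : ∀ n, (Rn l n)⁻¹ * ∑ p ∈ PF l n, Eloc l U k n p = EL l U (n + k) := by
  induction k with
  | zero => intro n; rfl
  | succ k ih =>
    intro n
    rw [show n + (k + 1) = n + 1 + k by ring, ← ih (n + 1), sum_PF_succ hl, Rn_succ, mul_inv, mul_assoc,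
      Finset.mul_sum (PF l n) _ (rl (l n))⁻¹]
    rfl

lemma compat_corner (hU : Compat l U) (n : ℕ) (p : ℕ × ℕ) :
    U (n + 1) (child (l n) p (0, 0)) = U n p ∧
    U (n + 1) (child (l n) p (l n, 0)) = U n (p.1 + 1, p.2) ∧
    U (n + 1) (child (l n) p (0, l n)) = U n (p.1, p.2 + 1) := by
  unfold child
  refine ⟨?_, ?_, ?_⟩
  · exact hU n p.1 p.2
  · exact hU n (p.1 + 1) p.2
  · exact hU n p.1 (p.2 + 1)

lemma ec_child_le (hU : Compat l U) (n : ℕ) (p : ℕ × ℕ) :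
    ec (U n) p ≤ (rl (l n))⁻¹ * ∑ i ∈ SF (l n), ec (U (n + 1)) (child (l n) p i) := by
  have h := trace_le (hl n) (fun v => U (n + 1) (child (l n) p v))
  obtain ⟨h0, h1, h2⟩ := compat_corner hl hU n p
  simp only [h0, h1, h2] at h
  rw [inv_mul_eq_div, le_div_iff₀' (rl_pos (hl n))]
  exact h

lemma ec_le_Eloc (hU : Compat l U) (k : ℕ) : ∀ n p, ec (U n) p ≤ Eloc l U k n p := by
  induction k with
  | zero => intro n p; exact le_rfl
  | succ k ih =>
    intro n p
    refine (ec_child_le hl hU n p).trans ?_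
    unfold Eloc
    have := (rl_pos (hl n)).le
    gcongr
    exact ih _ _

lemma Eloc_nonneg (hU : Compat l U) (k n : ℕ) (p) : 0 ≤ Eloc l U k n p :=
  (ec3_nonneg _ _ _).trans (ec_le_Eloc hl hU k n p)

lemma EL_mono (hU : Compat l U) : Monotone (EL l U) := by
  apply monotone_nat_of_le_succ
  intro n
  rw [← sum_Eloc hl 1 n]
  unfold EL
  have := (Rn_pos hl n).le
  gcongr
  exact ec_le_Eloc hl hU 1 _ _

lemma Eloc_le (hU : Compat l U) (k n : ℕ) {p} (hp : p ∈ PF l n) :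
    Eloc l U k n p ≤ Rn l n * EL l U (n + k) := by
  rw [← sum_Eloc hl k n, ← mul_assoc, mul_inv_cancel₀ (Rn_pos hl n).ne', one_mul]
  exact Finset.single_le_sum (f := fun p => Eloc l U k n p) (fun i _ => Eloc_nonneg hl hU k n i) hp

lemma desc_bound (hU : Compat l U) (k : ℕ) : ∀ n p x v, Desc l k n p x → IsV p v →
    (U (n + k) x - U n v) ^ 2 ≤ 2 * Eloc l U k n p := by
  induction k with
  | zero =>
    intro n p x v hx hv
    have := ec_vert (U n) hx hv
    have h2 : 0 ≤ (U n x - U n v) ^ 2 := sq_nonneg _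
    show (U n x - U n v) ^ 2 ≤ 2 * ec (U n) p
    linarith
  | succ k ih =>
    intro n p x v hx hv
    obtain ⟨i, hi, hx⟩ := hx
    obtain ⟨h0, h1, h2⟩ := compat_corner hl hU n p
    have key : ∃ κ, (κ = (0, 0) ∨ κ = (l n, 0) ∨ κ = (0, l n)) ∧ U (n + 1) (child (l n) p κ) = U n v := by
      rcases hv with rfl | rfl | rfl
      · exact ⟨_, Or.inl rfl, h0⟩
      · exact ⟨_, Or.inr (Or.inl rfl), h1⟩
      · exact ⟨_, Or.inr (Or.inr rfl), h2⟩
    obtain ⟨κ, hκ, hv'⟩ := key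
    rw [← hv', show n + (k + 1) = n + 1 + k by ring]
    refine energy_step (hl n) (fun v => U (n + 1) (child (l n) p v))
      (fun i => Eloc l U k (n + 1) (child (l n) p i)) ?_ _ hi ?_ hκ
    · intro j hj
      exact ec_le_Eloc hl hU k (n + 1) (child (l n) p j)
    · intro w hw
      apply ih _ _ _ _ hx
      rcases hw with rfl | rfl | rfl
      · exact Or.inl rfl
      · exact Or.inr (Or.inl rfl)
      · exact Or.inr (Or.inr rfl)

omit hl in
lemma exists_desc (k : ℕ) : ∀ n p' x, p' ∈ PF l (n + k) → IsV p' x → ∃ p ∈ PF l n, Desc l k n p x := by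
  induction k with
  | zero => intro n p' x h hx; exact ⟨p', h, hx⟩
  | succ k ih =>
    intro n p' x h hx
    rw [show n + (k + 1) = n + 1 + k by ring] at h
    obtain ⟨p1, h1, hd⟩ := ih _ _ _ h hx
    obtain ⟨p, hp, i, hi, rfl⟩ := mem_PF_succ.1 h1
    exact ⟨p, hp, i, hi, hd⟩

lemma vert_up (n : ℕ) {p v : ℕ × ℕ} (hp : p ∈ PF l n) (hv : IsV p v) :
    ∃ p' ∈ PF l (n + 1), IsV p' (l n * v.1, l n * v.2) := by
  have := hl n
  rcases hv with rfl | rfl | rfl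
  · exact ⟨child (l n) v (0, 0), mem_PF_succ.2 ⟨_, hp, (0, 0), by rw [mem_SF_iff (hl n)]; omega, rfl⟩,
      Or.inl rfl⟩
  · refine ⟨child (l n) p (l n - 1, 0), mem_PF_succ.2 ⟨_, hp, _, by rw [mem_SF_iff (hl n)]; omega, rfl⟩,
      Or.inr (Or.inl ?_)⟩
    simp only [child, Prod.mk.injEq, mul_add]; omega
  · refine ⟨child (l n) p (0, l n - 1), mem_PF_succ.2 ⟨_, hp, _, by rw [mem_SF_iff (hl n)]; omega, rfl⟩,
      Or.inr (Or.inr ?_)⟩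
    simp only [child, Prod.mk.injEq, mul_add]; omega

end

/-- Harmonic extension of a level `N` lattice function. -/
def HX (l : ℕ → ℕ) (N : ℕ) (U0 : ℕ × ℕ → ℝ) : ℕ → ℕ × ℕ → ℝ
  | 0 => U0
  | k + 1 => fun v =>
    harm (l (N + k)) (HX l N U0 k (v.1 / l (N + k), v.2 / l (N + k)))
      (HX l N U0 k (v.1 / l (N + k) + 1, v.2 / l (N + k)))
      (HX l N U0 k (v.1 / l (N + k), v.2 / l (N + k) + 1)) (v.1 % l (N + k), v.2 % l (N + k))

section
variable {l : ℕ → ℕ} (hl : ∀ n, 5 ≤ l n) (N : ℕ) (U0 : ℕ × ℕ → ℝ)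
include hl

lemma HX_compat (k a b : ℕ) :
    HX l N U0 (k + 1) (l (N + k) * a, l (N + k) * b) = HX l N U0 k (a, b) := by
  have := hl (N + k)
  simp only [HX]
  rw [Nat.mul_div_cancel_left _ (by omega), Nat.mul_div_cancel_left _ (by omega), Nat.mul_mod_right,
    Nat.mul_mod_right, harm_00 (hl _)]

lemma HX_child (k : ℕ) (p : ℕ × ℕ) (i j : ℕ) (hij : i + j ≤ l (N + k)) :
    HX l N U0 (k + 1) (child (l (N + k)) p (i, j)) =
    harm (l (N + k)) (HX l N U0 k p) (HX l N U0 k (p.1 + 1, p.2)) (HX l N U0 k (p.1, p.2 + 1)) (i, j) := by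
  have h5 := hl (N + k)
  by_cases h1 : i = l (N + k)
  · obtain rfl : j = 0 := by omega
    rw [h1, harm_10 (hl _)]; exact HX_compat hl N U0 k (p.1 + 1) p.2
  by_cases h2 : j = l (N + k)
  · obtain rfl : i = 0 := by omega
    rw [h2, harm_01 (hl _)]; exact HX_compat hl N U0 k p.1 (p.2 + 1)
  have e : ∀ a b, b < l (N + k) → (l (N + k) * a + b) / l (N + k) = a ∧ (l (N + k) * a + b) % l (N + k) = b := by
    intro a b hb
    rw [Nat.mul_add_div (by omega), Nat.div_eq_of_lt hb, Nat.mul_add_mod, Nat.mod_eq_of_lt hb]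
    simp
  simp only [HX, child]
  rw [(e _ _ _).1, (e _ _ _).1, (e _ _ _).2, (e _ _ _).2]
  all_goals omega

lemma HX_energy (k : ℕ) (p : ℕ × ℕ) :
    (rl (l (N + k)))⁻¹ * ∑ i ∈ SF (l (N + k)), ec (HX l N U0 (k + 1)) (child (l (N + k)) p i) =
      ec (HX l N U0 k) p := by
  have h := harm_energy (hl (N + k)) (HX l N U0 k p) (HX l N U0 k (p.1 + 1, p.2))
    (HX l N U0 k (p.1, p.2 + 1))
  have h2 : ∑ i ∈ SF (l (N + k)), ec (HX l N U0 (k + 1)) (child (l (N + k)) p i) =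
      rl (l (N + k)) * ec (HX l N U0 k) p := by
    refine Eq.trans (Finset.sum_congr rfl ?_) h
    rintro ⟨i, j⟩ hi
    have hlt := SF_lt (hl _) hi
    simp only at hlt
    have e0 := HX_child hl N U0 k p i j (by omega)
    have e1 := HX_child hl N U0 k p (i + 1) j (by omega)
    have e2 := HX_child hl N U0 k p i (j + 1) (by omega)
    unfold ec
    simp only
    rw [← e0, ← e1, ← e2]
    rfl
  rw [h2, inv_mul_cancel_left₀ (rl_pos (hl _)).ne']

lemma HX_Eloc {U : ℕ → ℕ × ℕ → ℝ} (hU : ∀ k, U (N + k) = HX l N U0 k) (k : ℕ) :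
    ∀ j p, Eloc l U k (N + j) p = ec (HX l N U0 j) p := by
  induction k with
  | zero => intro j p; unfold Eloc; rw [hU]
  | succ k ih =>
    intro j p
    rw [← HX_energy hl]
    unfold Eloc
    congr 1
    apply Finset.sum_congr rfl
    intro i _
    exact ih (j + 1) _

end



/-! ### Geometry: affine coordinates -/

/-- Affine coordinates with respect to the triangle `q`. -/
def Ph (q : Fin 3 → E2) (s t : ℝ) : E2 := q 0 + s • (q 1 - q 0) + t • (q 2 - q 0)

/-- Lattice points of level `n`. -/
def pt (q : Fin 3 → E2) (l : ℕ → ℕ) (n : ℕ) (v : ℕ × ℕ) : E2 :=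
  Ph q ((v.1 : ℝ) / Ln l n) ((v.2 : ℝ) / Ln l n)

/-- Position of a word. -/
def wpos (l : ℕ → ℕ) (w : ℕ → ℕ × ℕ) : ℕ → ℕ × ℕ
  | 0 => (0, 0)
  | n + 1 => child (l n) (wpos l w n) (w n)

lemma Ln_succ (l : ℕ → ℕ) (n : ℕ) : Ln l (n + 1) = Ln l n * l n := by
  unfold Ln; rw [Finset.prod_range_succ]

lemma Ln_pos {l : ℕ → ℕ} (hl : ∀ n, 5 ≤ l n) (n : ℕ) : 0 < Ln l n :=
  Finset.prod_pos fun k _ => by have := hl k; omega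

lemma LnR_pos {l : ℕ → ℕ} (hl : ∀ n, 5 ≤ l n) (n : ℕ) : (0 : ℝ) < Ln l n := by
  exact_mod_cast Ln_pos hl n

lemma LnR_succ (l : ℕ → ℕ) (n : ℕ) : (Ln l (n + 1) : ℝ) = Ln l n * l n := by
  rw [Ln_succ]; push_cast; ring

section
variable {q : Fin 3 → E2} (hq : ∀ j k : Fin 3, j ≠ k → dist (q j) (q k) = 1)
include hq

lemma q_inner : inner ℝ (q 1 - q 0) (q 1 - q 0) = (1 : ℝ) ∧ inner ℝ (q 2 - q 0) (q 2 - q 0) = (1 : ℝ) ∧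
    inner ℝ (q 1 - q 0) (q 2 - q 0) = (1 / 2 : ℝ) := by
  have h1 := hq 1 0 (by decide)
  have h2 := hq 2 0 (by decide)
  have h3 := hq 1 2 (by decide)
  rw [dist_eq_norm] at h1 h2 h3
  have e : q 1 - q 2 = (q 1 - q 0) - (q 2 - q 0) := by abel
  rw [e] at h3
  have h4 := norm_sub_sq_real (q 1 - q 0) (q 2 - q 0)
  rw [h1, h2, h3] at h4
  refine ⟨?_, ?_, by linarith⟩
  · rw [real_inner_self_eq_norm_sq, h1]; norm_num
  · rw [real_inner_self_eq_norm_sq, h2]; norm_num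

lemma Ph_dist (s t s' t' : ℝ) : dist (Ph q s t) (Ph q s' t') ^ 2 =
    (s - s') ^ 2 + (s - s') * (t - t') + (t - t') ^ 2 := by
  obtain ⟨h1, h2, h3⟩ := q_inner hq
  have e : Ph q s t - Ph q s' t' = (s - s') • (q 1 - q 0) + (t - t') • (q 2 - q 0) := by
    unfold Ph; module
  rw [dist_eq_norm, e, ← real_inner_self_eq_norm_sq]
  simp only [inner_add_left, inner_add_right, inner_smul_left, inner_smul_right, h1, h2, h3,
    real_inner_comm (q 1 - q 0) (q 2 - q 0)]
  simp
  ring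

lemma Ph_inj {s t s' t' : ℝ} (h : Ph q s t = Ph q s' t') : s = s' ∧ t = t' := by
  have h1 := Ph_dist hq s t s' t'
  rw [h, dist_self] at h1
  have h2 : s - s' = 0 := by nlinarith [sq_nonneg (s - s' + 2 * (t - t')), sq_nonneg (s - s')]
  have h3 : t - t' = 0 := by nlinarith [sq_nonneg (t - t' + 2 * (s - s')), sq_nonneg (t - t')]
  constructor <;> linarith

end

lemma Ph_comb (q : Fin 3 → E2) (a b s t s' t' : ℝ) (h : a + b = 1) :
    a • Ph q s t + b • Ph q s' t' = Ph q (a * s + b * s') (a * t + b * t') := by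
  obtain rfl : a = 1 - b := by linarith
  unfold Ph; module

lemma Ph_00 (q : Fin 3 → E2) : Ph q 0 0 = q 0 := by simp [Ph]
lemma Ph_10 (q : Fin 3 → E2) : Ph q 1 0 = q 1 := by simp [Ph]
lemma Ph_01 (q : Fin 3 → E2) : Ph q 0 1 = q 2 := by simp [Ph]

lemma mem_Tri (q : Fin 3 → E2) (x : E2) :
    x ∈ Tri q ↔ ∃ s t : ℝ, 0 ≤ s ∧ 0 ≤ t ∧ s + t ≤ 1 ∧ x = Ph q s t := by
  constructor
  · intro hx
    have hsub : Tri q ⊆ {x | ∃ s t : ℝ, 0 ≤ s ∧ 0 ≤ t ∧ s + t ≤ 1 ∧ x = Ph q s t} := by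
      apply convexHull_min
      · rintro _ ⟨j, rfl⟩
        fin_cases j
        · exact ⟨0, 0, by norm_num, by norm_num, by norm_num, (Ph_00 q).symm⟩
        · exact ⟨1, 0, by norm_num, by norm_num, by norm_num, (Ph_10 q).symm⟩
        · exact ⟨0, 1, by norm_num, by norm_num, by norm_num, (Ph_01 q).symm⟩
      · rintro _ ⟨s, t, h1, h2, h3, rfl⟩ _ ⟨s', t', h1', h2', h3', rfl⟩ a b ha hb hab
        refine ⟨_, _, ?_, ?_, ?_, Ph_comb q a b s t s' t' hab⟩
        · positivity
        · positivity
        · nlinarith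
    exact hsub hx
  · rintro ⟨s, t, h1, h2, h3, rfl⟩
    have hc : Convex ℝ (Tri q) := convex_convexHull ℝ _
    have hm : ∀ j, q j ∈ Tri q := fun j => subset_convexHull ℝ _ ⟨j, rfl⟩
    have := hc.sum_mem (t := Finset.univ) (w := ![1 - s - t, s, t]) (z := q)
      (by intro i _; fin_cases i <;> simp <;> linarith) (by simp [Fin.sum_univ_three]; ring)
      (fun i _ => hm i)
    convert this using 1
    rw [Fin.sum_univ_three]
    simp [Ph]
    module

lemma fmap_Ph (q : Fin 3 → E2) (l : ℕ) (i : ℕ × ℕ) (s t : ℝ) :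
    fmap q l i (Ph q s t) = Ph q ((i.1 + s) / l) ((i.2 + t) / l) := by
  unfold fmap Ph
  simp only [add_div]
  module

lemma wordMap_Ph (q : Fin 3 → E2) {l : ℕ → ℕ} (hl : ∀ n, 5 ≤ l n) (w : ℕ → ℕ × ℕ) (n : ℕ) :
    ∀ s t : ℝ, wordMap q l w n (Ph q s t) =
      Ph q (((wpos l w n).1 + s) / Ln l n) (((wpos l w n).2 + t) / Ln l n) := by
  induction n with
  | zero => intro s t; simp [wordMap, wpos, Ln]
  | succ n ih =>
    intro s t
    have h1 := LnR_pos hl n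
    have h2 : (0 : ℝ) < l n := by have := hl n; positivity
    simp only [wordMap, Function.comp]
    rw [fmap_Ph, ih, LnR_succ]
    simp only [wpos, child]
    push_cast
    congr 1 <;> field_simp <;> ring

lemma wpos_mem {l : ℕ → ℕ} (hl : ∀ n, 5 ≤ l n) {w : ℕ → ℕ × ℕ} (n : ℕ)
    (hw : ∀ k, k < n → w k ∈ Sset (l k)) : wpos l w n ∈ PF l n := by
  induction n with
  | zero => simp [wpos, PF]
  | succ n ih =>
    exact mem_PF_succ.2 ⟨_, ih fun k hk => hw k (by omega), _, (mem_SF (hl n) _).2 (hw n (by omega)), rfl⟩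

lemma wpos_congr {l : ℕ → ℕ} {w w' : ℕ → ℕ × ℕ} (n : ℕ) (h : ∀ k, k < n → w k = w' k) :
    wpos l w n = wpos l w' n := by
  induction n with
  | zero => rfl
  | succ n ih => simp only [wpos]; rw [ih fun k hk => h k (by omega), h n (by omega)]

lemma wpos_inj {l : ℕ → ℕ} (hl : ∀ n, 5 ≤ l n) {w w' : ℕ → ℕ × ℕ} (n : ℕ)
    (hw : ∀ k, k < n → w k ∈ Sset (l k)) (hw' : ∀ k, k < n → w' k ∈ Sset (l k))
    (h : wpos l w n = wpos l w' n) : ∀ k, k < n → w k = w' k := by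
  induction n with
  | zero => intro k hk; omega
  | succ n ih =>
    have a := SF_lt (hl n) ((mem_SF (hl n) _).2 (hw n (by omega)))
    have b := SF_lt (hl n) ((mem_SF (hl n) _).2 (hw' n (by omega)))
    obtain ⟨h1, h2⟩ := child_inj a.2.1 a.2.2 b.2.1 b.2.2 h
    intro k hk
    by_cases hkn : k = n
    · subst hkn; exact h2
    · exact ih (fun k hk => hw k (by omega)) (fun k hk => hw' k (by omega)) h1 k (by omega)

lemma wpos_surj {l : ℕ → ℕ} (hl : ∀ n, 5 ≤ l n) (n : ℕ) : ∀ p ∈ PF l n,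
    ∃ w ∈ Wn l n, wpos l w n = p := by
  induction n with
  | zero =>
    intro p hp
    refine ⟨fun _ => (0, 0), ⟨by intro k hk; omega, fun _ _ => rfl⟩, ?_⟩
    simp [PF] at hp
    rw [hp]; rfl
  | succ n ih =>
    intro p hp
    obtain ⟨p', hp', i, hi, rfl⟩ := mem_PF_succ.1 hp
    obtain ⟨w, hw, rfl⟩ := ih p' hp'
    refine ⟨Function.update w n i, ⟨?_, ?_⟩, ?_⟩
    · intro k hk
      by_cases hkn : k = n
      · subst hkn; simp; exact (mem_SF (hl k) _).1 hi
      · rw [Function.update_of_ne hkn]; exact hw.1 k (by omega)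
    · intro k hk
      rw [Function.update_of_ne (by omega)]; exact hw.2 k (by omega)
    · simp only [wpos, Function.update_self]
      rw [wpos_congr (w' := w)]
      intro k hk
      rw [Function.update_of_ne (by omega)]

lemma wpos_bijOn {l : ℕ → ℕ} (hl : ∀ n, 5 ≤ l n) (n : ℕ) :
    Set.BijOn (fun w => wpos l w n) (Wn l n) (PF l n : Set (ℕ × ℕ)) := by
  refine ⟨fun w hw => wpos_mem hl n hw.1, ?_, ?_⟩
  · intro w hw w' hw' h
    funext k
    by_cases hk : k < n
    · exact wpos_inj hl n hw.1 hw'.1 h k hk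
    · rw [hw.2 k (by omega), hw'.2 k (by omega)]
  · intro p hp
    obtain ⟨w, hw, h⟩ := wpos_surj hl n p hp
    exact ⟨w, hw, h⟩

/-- Lattice functions of a function on the plane. -/
def lat (q : Fin 3 → E2) (l : ℕ → ℕ) (u : E2 → ℝ) (n : ℕ) (v : ℕ × ℕ) : ℝ := u (pt q l n v)

lemma pt_scale (q : Fin 3 → E2) {l : ℕ → ℕ} (hl : ∀ n, 5 ≤ l n) (n a b : ℕ) :
    pt q l (n + 1) (l n * a, l n * b) = pt q l n (a, b) := by
  have h1 := LnR_pos hl n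
  have h2 : (0 : ℝ) < l n := by have := hl n; positivity
  unfold pt
  rw [LnR_succ]
  push_cast
  congr 1 <;> field_simp

lemma lat_compat (q : Fin 3 → E2) {l : ℕ → ℕ} (hl : ∀ n, 5 ≤ l n) (u : E2 → ℝ) :
    Compat l (lat q l u) := fun n a b => by
  unfold lat; rw [pt_scale q hl]

lemma wordMap_vert (q : Fin 3 → E2) {l : ℕ → ℕ} (hl : ∀ n, 5 ≤ l n) (w : ℕ → ℕ × ℕ) (n : ℕ) :
    wordMap q l w n (q 0) = pt q l n (wpos l w n) ∧
    wordMap q l w n (q 1) = pt q l n ((wpos l w n).1 + 1, (wpos l w n).2) ∧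
    wordMap q l w n (q 2) = pt q l n ((wpos l w n).1, (wpos l w n).2 + 1) := by
  rw [← Ph_00 q, ← Ph_10 q, ← Ph_01 q, wordMap_Ph q hl, wordMap_Ph q hl, wordMap_Ph q hl]
  unfold pt
  simp only [add_zero, Nat.cast_add, Nat.cast_one, true_and, Ph_00, Ph_10, Ph_01]

lemma En_eq (q : Fin 3 → E2) {l : ℕ → ℕ} (hl : ∀ n, 5 ≤ l n) (n : ℕ) (u : E2 → ℝ) :
    En q l n u u = EL l (lat q l u) n := by
  unfold En EL
  congr 1
  rw [← finsum_mem_coe_finset]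
  apply finsum_mem_eq_of_bijOn _ (wpos_bijOn hl n)
  intro w hw
  obtain ⟨h0, h1, h2⟩ := wordMap_vert q hl w n
  unfold E0 ec ec3 lat
  simp only [Fin.sum_univ_three, Function.comp, h0, h1, h2]
  ring



/-! ### Geometry: cells -/

/-- Affine coordinates inside of the cell `p` of size `1 / L`. -/
def InT (L : ℝ) (p : ℕ × ℕ) (s t : ℝ) : Prop :=
  (p.1 : ℝ) ≤ L * s ∧ (p.2 : ℝ) ≤ L * t ∧ L * (s + t) ≤ p.1 + p.2 + 1

/-- The closed triangle of level `n` at position `p`. -/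
def TT (q : Fin 3 → E2) (l : ℕ → ℕ) (n : ℕ) (p : ℕ × ℕ) : Set E2 :=
  {x | ∃ s t, InT (Ln l n) p s t ∧ x = Ph q s t}

lemma fmap_cont (q : Fin 3 → E2) (l : ℕ) (i : ℕ × ℕ) : Continuous (fmap q l i) := by
  unfold fmap; fun_prop

lemma wordMap_cont (q : Fin 3 → E2) (l : ℕ → ℕ) (w : ℕ → ℕ × ℕ) (n : ℕ) :
    Continuous (wordMap q l w n) := by
  induction n with
  | zero => exact continuous_id
  | succ n ih => exact ih.comp (fmap_cont _ _ _)

lemma Tri_compact (q : Fin 3 → E2) : IsCompact (Tri q) :=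
  (Set.finite_range q).isCompact_convexHull ℝ

section
variable (q : Fin 3 → E2) {l : ℕ → ℕ} (hl : ∀ n, 5 ≤ l n)
include hl

lemma TT_eq (w : ℕ → ℕ × ℕ) (n : ℕ) : wordMap q l w n '' Tri q = TT q l n (wpos l w n) := by
  have hL := LnR_pos hl n
  ext x
  constructor
  · rintro ⟨y, hy, rfl⟩
    obtain ⟨s, t, h1, h2, h3, rfl⟩ := (mem_Tri q y).1 hy
    rw [wordMap_Ph q hl]
    refine ⟨_, _, ⟨?_, ?_, ?_⟩, rfl⟩
    · rw [mul_div_cancel₀ _ hL.ne']; linarith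
    · rw [mul_div_cancel₀ _ hL.ne']; linarith
    · rw [mul_add, mul_div_cancel₀ _ hL.ne', mul_div_cancel₀ _ hL.ne']; linarith
  · rintro ⟨s, t, ⟨h1, h2, h3⟩, rfl⟩
    refine ⟨Ph q (Ln l n * s - (wpos l w n).1) (Ln l n * t - (wpos l w n).2), ?_, ?_⟩
    · rw [mem_Tri]
      exact ⟨_, _, by linarith, by linarith, by linarith, rfl⟩
    · rw [wordMap_Ph q hl]
      congr 1
      · field_simp; ring
      · field_simp; ring

lemma TT_compact (n : ℕ) {p : ℕ × ℕ} (hp : p ∈ PF l n) : IsCompact (TT q l n p) := by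
  obtain ⟨w, -, rfl⟩ := wpos_surj hl n p hp
  rw [← TT_eq q hl]
  exact (Tri_compact q).image (wordMap_cont q l w n)

lemma mem_Gasket (x : E2) : x ∈ Gasket q l ↔ ∀ n, ∃ p ∈ PF l n, x ∈ TT q l n p := by
  unfold Gasket
  simp only [Set.mem_iInter, Set.mem_iUnion, exists_prop]
  refine forall_congr' fun n => ?_
  constructor
  · rintro ⟨w, hw, hx⟩
    exact ⟨_, wpos_mem hl n hw.1, by rwa [← TT_eq q hl]⟩
  · rintro ⟨p, hp, hx⟩
    obtain ⟨w, hw, rfl⟩ := wpos_surj hl n p hp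
    exact ⟨w, hw, by rwa [TT_eq q hl]⟩

lemma mem_Vn (x : E2) (n : ℕ) : x ∈ Vn q l n ↔ ∃ p ∈ PF l n, ∃ v, IsV p v ∧ x = pt q l n v := by
  unfold Vn V0
  simp only [Set.mem_iUnion, exists_prop]
  constructor
  · rintro ⟨w, hw, _, ⟨j, rfl⟩, rfl⟩
    obtain ⟨h0, h1, h2⟩ := wordMap_vert q hl w n
    refine ⟨_, wpos_mem hl n hw.1, ?_⟩
    fin_cases j
    · exact ⟨_, Or.inl rfl, h0⟩
    · exact ⟨_, Or.inr (Or.inl rfl), h1⟩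
    · exact ⟨_, Or.inr (Or.inr rfl), h2⟩
  · rintro ⟨p, hp, v, hv, rfl⟩
    obtain ⟨w, hw, rfl⟩ := wpos_surj hl n p hp
    obtain ⟨h0, h1, h2⟩ := wordMap_vert q hl w n
    rcases hv with rfl | rfl | rfl
    · exact ⟨w, hw, q 0, ⟨0, rfl⟩, h0⟩
    · exact ⟨w, hw, q 1, ⟨1, rfl⟩, h1⟩
    · exact ⟨w, hw, q 2, ⟨2, rfl⟩, h2⟩

lemma Vn_mono : Monotone (Vn q l) := by
  apply monotone_nat_of_le_succ
  intro n x hx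
  obtain ⟨p, hp, v, hv, rfl⟩ := (mem_Vn q hl x n).1 hx
  obtain ⟨p', hp', hv'⟩ := vert_up hl n hp hv
  exact (mem_Vn q hl _ _).2 ⟨p', hp', _, hv', (pt_scale q hl n v.1 v.2).symm⟩

/-- Every vertex of `V_*` has lattice coordinates inside of a cell of level `n`. -/
lemma Vstar_desc {x : E2} (hx : x ∈ Vstar q l) (n : ℕ) :
    ∃ p ∈ PF l n, ∃ k v, Desc l k n p v ∧ x = pt q l (n + k) v := by
  obtain ⟨m, hm⟩ := Set.mem_iUnion.1 hx
  have h1 := Vn_mono q hl (Nat.le_add_left m n) hm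
  obtain ⟨p', hp', v, hv, rfl⟩ := (mem_Vn q hl _ _).1 h1
  obtain ⟨p, hp, hd⟩ := exists_desc m n p' v hp' hv
  exact ⟨p, hp, m, v, hd, rfl⟩

lemma child_InT (n : ℕ) (p i : ℕ × ℕ) (s t : ℝ) : InT (Ln l (n + 1)) (child (l n) p i) s t ↔
    InT (l n) i (Ln l n * s - p.1) (Ln l n * t - p.2) := by
  unfold InT child
  rw [LnR_succ]
  push_cast
  constructor <;> rintro ⟨h1, h2, h3⟩ <;> refine ⟨?_, ?_, ?_⟩ <;> linarith

lemma TT_child (n : ℕ) {p i : ℕ × ℕ} (hi : i ∈ SF (l n)) : TT q l (n + 1) (child (l n) p i) ⊆ TT q l n p := by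
  rintro x ⟨s, t, h, rfl⟩
  rw [child_InT hl] at h
  obtain ⟨h1, h2, h3⟩ := h
  have h5 := SF_lt (hl n) hi
  have h6 : ((i.1 + i.2 + 1 : ℕ) : ℝ) ≤ l n := by exact_mod_cast h5.1
  push_cast at h6
  have hm : (0 : ℝ) < l n := by have := hl n; positivity
  refine ⟨s, t, ⟨?_, ?_, ?_⟩, rfl⟩
  · have : 0 ≤ Ln l n * s - p.1 := by
      by_contra hc
      push Not at hc
      have := mul_neg_of_pos_of_neg hm hc
      have : (0 : ℝ) ≤ i.1 := by positivity
      linarith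
    linarith
  · have : 0 ≤ Ln l n * t - p.2 := by
      by_contra hc
      push Not at hc
      have := mul_neg_of_pos_of_neg hm hc
      have : (0 : ℝ) ≤ i.2 := by positivity
      linarith
    linarith
  · have : (l n : ℝ) * ((Ln l n * s - p.1) + (Ln l n * t - p.2)) ≤ l n * 1 := by linarith
    have := le_of_mul_le_mul_left this hm
    linarith

omit hl in
lemma pt_mem_TT (hl : ∀ n, 5 ≤ l n) (n : ℕ) {p v : ℕ × ℕ} (h : IsV p v) : pt q l n v ∈ TT q l n p := by
  have hL := LnR_pos hl n
  refine ⟨_, _, ⟨?_, ?_, ?_⟩, rfl⟩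
  · rw [mul_div_cancel₀ _ hL.ne']; rcases h with rfl | rfl | rfl <;> push_cast <;> linarith
  · rw [mul_div_cancel₀ _ hL.ne']; rcases h with rfl | rfl | rfl <;> push_cast <;> linarith
  · rw [mul_add, mul_div_cancel₀ _ hL.ne', mul_div_cancel₀ _ hL.ne']
    rcases h with rfl | rfl | rfl <;> push_cast <;> linarith

lemma desc_mem_TT (k : ℕ) : ∀ n p x, Desc l k n p x → pt q l (n + k) x ∈ TT q l n p := by
  induction k with
  | zero => intro n p x h; exact pt_mem_TT q hl n h
  | succ k ih =>
    intro n p x h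
    obtain ⟨i, hi, h⟩ := h
    have := ih _ _ _ h
    rw [show n + (k + 1) = n + 1 + k by ring]
    exact TT_child q hl n hi this

end

/-- Coordinates on the boundary of a cell. -/
def InB (L : ℝ) (p : ℕ × ℕ) (s t : ℝ) : Prop :=
  InT L p s t ∧ (L * s = p.1 ∨ L * t = p.2 ∨ L * (s + t) = p.1 + p.2 + 1)

lemma floor_cap {m : ℕ} (hm : 1 ≤ m) {a : ℝ} (h0 : 0 ≤ a) (h1 : a ≤ m) :
    ∃ j : ℕ, j + 1 ≤ m ∧ (j : ℝ) ≤ a ∧ a ≤ j + 1 := by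
  by_cases h : a = m
  · refine ⟨m - 1, by omega, ?_, ?_⟩
    · rw [Nat.cast_sub hm, h]; push_cast; linarith
    · rw [Nat.cast_sub hm, h]; push_cast; linarith
  · refine ⟨⌊a⌋₊, ?_, Nat.floor_le h0, (Nat.lt_floor_add_one a).le⟩
    have : ⌊a⌋₊ < m := by
      rw [Nat.floor_lt h0]; exact lt_of_le_of_ne h1 h
    omega

lemma unit_child {m : ℕ} (hm : 5 ≤ m) {a b : ℝ} (ha : 0 ≤ a) (hb : 0 ≤ b) (hab : a + b ≤ 1)
    (h : a = 0 ∨ b = 0 ∨ a + b = 1) : ∃ i ∈ SF m, InB m i a b := by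
  have hm0 : (0 : ℝ) < m := by positivity
  have ma : 0 ≤ m * a := by positivity
  have mb : 0 ≤ m * b := by positivity
  have ma1 : m * a ≤ m := by nlinarith
  have mb1 : m * b ≤ m := by nlinarith
  rcases h with rfl | rfl | h
  · obtain ⟨j, h1, h2, h3⟩ := floor_cap (by omega) mb mb1
    refine ⟨(0, j), by rw [mem_SF_iff hm]; omega, ⟨?_, ?_, ?_⟩, Or.inl ?_⟩ <;> push_cast <;> linarith
  · obtain ⟨j, h1, h2, h3⟩ := floor_cap (by omega) ma ma1
    refine ⟨(j, 0), by rw [mem_SF_iff hm]; omega, ⟨?_, ?_, ?_⟩, Or.inr (Or.inl ?_)⟩ <;> push_cast <;> linarith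
  · obtain ⟨j, h1, h2, h3⟩ := floor_cap (by omega) ma ma1
    have e : m * (a + b) = m := by rw [h, mul_one]
    have e2 : ((m - 1 - j : ℕ) : ℝ) = m - 1 - j := by
      rw [Nat.cast_sub (by omega), Nat.cast_sub (by omega)]; push_cast; ring
    refine ⟨(j, m - 1 - j), by rw [mem_SF_iff hm]; omega, ⟨?_, ?_, ?_⟩, Or.inr (Or.inr ?_)⟩ <;>
      simp only [e2] <;> linarith

section
variable (q : Fin 3 → E2) {l : ℕ → ℕ} (hl : ∀ n, 5 ≤ l n)
include hl

lemma bdry_child (n : ℕ) {p : ℕ × ℕ} {s t : ℝ} (h : InB (Ln l n) p s t) :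
    ∃ i ∈ SF (l n), InB (Ln l (n + 1)) (child (l n) p i) s t := by
  obtain ⟨⟨h1, h2, h3⟩, h4⟩ := h
  obtain ⟨i, hi, hI, hB⟩ := unit_child (hl n) (a := Ln l n * s - p.1) (b := Ln l n * t - p.2)
    (by linarith) (by linarith) (by linarith)
    (by rcases h4 with h | h | h
        · left; linarith
        · right; left; linarith
        · right; right; linarith)
  refine ⟨i, hi, (child_InT hl n p i s t).2 hI, ?_⟩
  unfold child
  rw [LnR_succ]
  push_cast
  rcases hB with h | h | h
  · left; linarith
  · right; left; linarith
  · right; right; linarith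

lemma bdry_down (n : ℕ) {p : ℕ × ℕ} (hp : p ∈ PF l n) {s t : ℝ} (h : InB (Ln l n) p s t) (k : ℕ) :
    ∃ p' ∈ PF l (n + k), InB (Ln l (n + k)) p' s t := by
  induction k with
  | zero => exact ⟨p, hp, h⟩
  | succ k ih =>
    obtain ⟨p', hp', h'⟩ := ih
    obtain ⟨i, hi, hB⟩ := bdry_child hl _ h'
    exact ⟨_, mem_PF_succ.2 ⟨p', hp', i, hi, rfl⟩, hB⟩

lemma TT_up (n k : ℕ) {x : E2} (h : ∃ p ∈ PF l (n + k), x ∈ TT q l (n + k) p) :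
    ∃ p ∈ PF l n, x ∈ TT q l n p := by
  induction k with
  | zero => exact h
  | succ k ih =>
    obtain ⟨p', hp', hx⟩ := h
    obtain ⟨p, hp, i, hi, rfl⟩ := mem_PF_succ.1 (show p' ∈ PF l (n + k + 1) from hp')
    exact ih ⟨p, hp, TT_child q hl _ hi hx⟩

lemma bdry_mem_Gasket (n : ℕ) {p : ℕ × ℕ} (hp : p ∈ PF l n) {s t : ℝ} (h : InB (Ln l n) p s t) :
    Ph q s t ∈ Gasket q l := by
  rw [mem_Gasket q hl]
  intro m
  obtain ⟨p', hp', hB⟩ := bdry_down hl n hp h m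
  apply TT_up q hl m n
  rw [add_comm m n]
  exact ⟨p', hp', s, t, hB.1, rfl⟩

/-- Edges of cells belong to the gasket. -/
lemma segment_mem (n : ℕ) {p v v' : ℕ × ℕ} (hp : p ∈ PF l n) (hv : IsV p v) (hv' : IsV p v') {θ : ℝ}
    (h0 : 0 ≤ θ) (h1 : θ ≤ 1) : (1 - θ) • pt q l n v + θ • pt q l n v' ∈ Gasket q l := by
  have hL := LnR_pos hl n
  unfold pt
  rw [Ph_comb _ _ _ _ _ _ _ (by ring)]
  apply bdry_mem_Gasket q hl n hp
  have e : ∀ a b : ℝ, (Ln l n : ℝ) * ((1 - θ) * (a / Ln l n) + θ * (b / Ln l n)) = (1 - θ) * a + θ * b := by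
    intro a b; field_simp
  unfold InB InT
  rw [e, e, mul_add (Ln l n : ℝ) (_ + _) (_ + _), e, e]
  obtain ⟨p1, p2⟩ := p
  rcases hv with rfl | rfl | rfl <;> rcases hv' with rfl | rfl | rfl <;>
    refine ⟨⟨?_, ?_, ?_⟩, ?_⟩ <;> push_cast <;>
    first
      | linarith
      | (left; linarith)
      | (right; left; linarith)
      | (right; right; linarith)

lemma pt_mem_Gasket (n : ℕ) {p v : ℕ × ℕ} (hp : p ∈ PF l n) (hv : IsV p v) : pt q l n v ∈ Gasket q l := by
  have := segment_mem q hl n hp hv hv (θ := 0) le_rfl zero_le_one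
  simpa using this

lemma Vstar_sub : Vstar q l ⊆ Gasket q l := by
  intro x hx
  obtain ⟨n, hn⟩ := Set.mem_iUnion.1 hx
  obtain ⟨p, hp, v, hv, rfl⟩ := (mem_Vn q hl x n).1 hn
  exact pt_mem_Gasket q hl n hp hv

lemma Gasket_compact : IsCompact (Gasket q l) := by
  have hc : IsClosed (Gasket q l) := by
    have : Gasket q l = ⋂ n, ⋃ p ∈ PF l n, TT q l n p := by
      ext x
      rw [mem_Gasket q hl]
      simp
    rw [this]
    apply isClosed_iInter
    intro n
    exact (PF l n).finite_toSet.isClosed_biUnion fun p hp => (TT_compact q hl n hp).isClosed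
  have h0 : (0, 0) ∈ PF l 0 := by simp [PF]
  refine (TT_compact q hl 0 h0).of_isClosed_subset hc ?_
  intro x hx
  obtain ⟨p, hp, hx⟩ := (mem_Gasket q hl x).1 hx 0
  simp [PF] at hp
  rwa [hp] at hx

end

section
variable {q : Fin 3 → E2} (hq : ∀ j k : Fin 3, j ≠ k → dist (q j) (q k) = 1)
  {l : ℕ → ℕ} (hl : ∀ n, 5 ≤ l n)
include hq hl

/-- Distinct cells meet only in a common vertex. -/
lemma TT_inter (n : ℕ) {p p' : ℕ × ℕ} (hne : p ≠ p') {x : E2} (hx : x ∈ TT q l n p) (hx' : x ∈ TT q l n p') :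
    ∃ v, IsV p v ∧ IsV p' v ∧ x = pt q l n v := by
  obtain ⟨s, t, ⟨h1, h2, h3⟩, rfl⟩ := hx
  obtain ⟨s', t', ⟨h1', h2', h3'⟩, he⟩ := hx'
  obtain ⟨rfl, rfl⟩ := Ph_inj hq he
  have hL := LnR_pos hl n
  rw [mul_add] at h3 h3'
  set X := (Ln l n : ℝ) * s with hX
  set Y := (Ln l n : ℝ) * t with hY
  have key : ∀ a b : ℕ, X = a → Y = b → Ph q s t = pt q l n (a, b) := by
    intro a b ha hb
    unfold pt
    congr 1
    · rw [eq_div_iff hL.ne']; simp only; linarith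
    · rw [eq_div_iff hL.ne']; simp only; linarith
  obtain ⟨a, b⟩ := p
  obtain ⟨a', b'⟩ := p'
  simp only [ne_eq, Prod.mk.injEq] at *
  have c1 : a' + b ≤ a + b + 1 := by
    have : ((a' + b : ℕ) : ℝ) ≤ ((a + b + 1 : ℕ) : ℝ) := by push_cast; linarith
    exact_mod_cast this
  have c2 : a' + b ≤ a' + b' + 1 := by
    have : ((a' + b : ℕ) : ℝ) ≤ ((a' + b' + 1 : ℕ) : ℝ) := by push_cast; linarith
    exact_mod_cast this
  have c3 : a + b' ≤ a + b + 1 := by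
    have : ((a + b' : ℕ) : ℝ) ≤ ((a + b + 1 : ℕ) : ℝ) := by push_cast; linarith
    exact_mod_cast this
  have c4 : a + b' ≤ a' + b' + 1 := by
    have : ((a + b' : ℕ) : ℝ) ≤ ((a' + b' + 1 : ℕ) : ℝ) := by push_cast; linarith
    exact_mod_cast this
  have c5 : a + b ≤ a' + b' + 1 := by
    have : ((a + b : ℕ) : ℝ) ≤ ((a' + b' + 1 : ℕ) : ℝ) := by push_cast; linarith
    exact_mod_cast this
  have c6 : a' + b' ≤ a + b + 1 := by
    have : ((a' + b' : ℕ) : ℝ) ≤ ((a + b + 1 : ℕ) : ℝ) := by push_cast; linarith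
    exact_mod_cast this
  have cases : (a' = a + 1 ∧ b' = b) ∨ (a = a' + 1 ∧ b' = b) ∨ (a' = a ∧ b' = b + 1) ∨
      (a' = a ∧ b = b' + 1) ∨ (a' = a + 1 ∧ b = b' + 1) ∨ (a = a' + 1 ∧ b' = b + 1) := by omega
  rcases cases with ⟨rfl, rfl⟩ | ⟨rfl, rfl⟩ | ⟨rfl, rfl⟩ | ⟨rfl, rfl⟩ | ⟨rfl, rfl⟩ | ⟨rfl, rfl⟩ <;>
    push_cast at *
  · exact ⟨(a + 1, b'), by simp [IsV], by simp [IsV], key _ _ (by push_cast; linarith) (by push_cast; linarith)⟩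
  · exact ⟨(a' + 1, b'), by simp [IsV], by simp [IsV], key _ _ (by push_cast; linarith) (by push_cast; linarith)⟩
  · exact ⟨(a', b + 1), by simp [IsV], by simp [IsV], key _ _ (by push_cast; linarith) (by push_cast; linarith)⟩
  · exact ⟨(a', b' + 1), by simp [IsV], by simp [IsV], key _ _ (by push_cast; linarith) (by push_cast; linarith)⟩
  · exact ⟨(a + 1, b' + 1), by simp [IsV], by simp [IsV], key _ _ (by push_cast; linarith) (by push_cast; linarith)⟩
  · exact ⟨(a' + 1, b + 1), by simp [IsV], by simp [IsV], key _ _ (by push_cast; linarith) (by push_cast; linarith)⟩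

/-- Cells without a common vertex are separated. -/
lemma TT_sep (n : ℕ) {p p' : ℕ × ℕ} (hne : ∀ v, IsV p v → ¬ IsV p' v) {x y : E2}
    (hx : x ∈ TT q l n p) (hy : y ∈ TT q l n p') : 3 / 4 ≤ (Ln l n : ℝ) ^ 2 * dist x y ^ 2 := by
  obtain ⟨s, t, ⟨h1, h2, h3⟩, rfl⟩ := hx
  obtain ⟨s', t', ⟨h1', h2', h3'⟩, rfl⟩ := hy
  rw [Ph_dist hq]
  have e : (Ln l n : ℝ) ^ 2 * ((s - s') ^ 2 + (s - s') * (t - t') + (t - t') ^ 2) =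
      (Ln l n * s - Ln l n * s') ^ 2 + (Ln l n * s - Ln l n * s') * (Ln l n * t - Ln l n * t')
      + (Ln l n * t - Ln l n * t') ^ 2 := by ring
  rw [e]
  rw [mul_add] at h3 h3'
  generalize (Ln l n : ℝ) * s = X at *
  generalize (Ln l n : ℝ) * t = Y at *
  generalize (Ln l n : ℝ) * s' = X' at *
  generalize (Ln l n : ℝ) * t' = Y' at *
  obtain ⟨a, b⟩ := p
  obtain ⟨a', b'⟩ := p'
  simp only at *
  have cases : a + 2 ≤ a' ∨ a' + 2 ≤ a ∨ b + 2 ≤ b' ∨ b' + 2 ≤ b ∨ a + b + 2 ≤ a' + b' ∨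
      a' + b' + 2 ≤ a + b := by
    by_contra hc
    have g1 := hne (a, b) (Or.inl rfl)
    have g2 := hne (a + 1, b) (Or.inr (Or.inl rfl))
    have g3 := hne (a, b + 1) (Or.inr (Or.inr rfl))
    unfold IsV at g1 g2 g3
    simp only [Prod.mk.injEq, true_and, and_true] at g1 g2 g3
    omega
  have hX : 1 ≤ (X - X') ^ 2 ∨ 1 ≤ (Y - Y') ^ 2 ∨ 1 ≤ ((X + Y) - (X' + Y')) ^ 2 := by
    rcases cases with c | c | c | c | c | c
    · have : ((a + 2 : ℕ) : ℝ) ≤ a' := by exact_mod_cast c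
      push_cast at this
      left; nlinarith
    · have : ((a' + 2 : ℕ) : ℝ) ≤ a := by exact_mod_cast c
      push_cast at this
      left; nlinarith
    · have : ((b + 2 : ℕ) : ℝ) ≤ b' := by exact_mod_cast c
      push_cast at this
      right; left; nlinarith
    · have : ((b' + 2 : ℕ) : ℝ) ≤ b := by exact_mod_cast c
      push_cast at this
      right; left; nlinarith
    · have : ((a + b + 2 : ℕ) : ℝ) ≤ ((a' + b' : ℕ) : ℝ) := by exact_mod_cast c
      push_cast at this
      right; right; nlinarith
    · have : ((a' + b' + 2 : ℕ) : ℝ) ≤ ((a + b : ℕ) : ℝ) := by exact_mod_cast c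
      push_cast at this
      right; right; nlinarith
  rcases hX with h | h | h
  · nlinarith [sq_nonneg ((X - X') + 2 * (Y - Y'))]
  · nlinarith [sq_nonneg (2 * (X - X') + (Y - Y'))]
  · nlinarith [sq_nonneg ((X - X') - (Y - Y'))]

lemma pt_dist_sq (n : ℕ) (v v' : ℕ × ℕ) : (Ln l n : ℝ) ^ 2 * dist (pt q l n v) (pt q l n v') ^ 2 =
    ((v.1 : ℝ) - v'.1) ^ 2 + ((v.1 : ℝ) - v'.1) * ((v.2 : ℝ) - v'.2) + ((v.2 : ℝ) - v'.2) ^ 2 := by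
  have hL := LnR_pos hl n
  unfold pt
  rw [Ph_dist hq]
  field_simp

lemma pt_dist_ge (n : ℕ) {v v' : ℕ × ℕ} (h : v ≠ v') : 1 / (Ln l n : ℝ) ≤ dist (pt q l n v) (pt q l n v') := by
  have hL := LnR_pos hl n
  have h1 := pt_dist_sq hq hl n v v'
  have h2 : (1 : ℝ) ≤ (Ln l n : ℝ) ^ 2 * dist (pt q l n v) (pt q l n v') ^ 2 := by
    rw [h1]
    have : (1 : ℤ) ≤ ((v.1 : ℤ) - v'.1) ^ 2 + ((v.1 : ℤ) - v'.1) * ((v.2 : ℤ) - v'.2) + ((v.2 : ℤ) - v'.2) ^ 2 := by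
      by_contra hc
      set c := (v.1 : ℤ) - v'.1 with hcdef
      set d := (v.2 : ℤ) - v'.2 with hddef
      have h3 : c ^ 2 + c * d + d ^ 2 ≤ 0 := by omega
      have h4 : c = 0 := by
        have : c ^ 2 ≤ 0 := by nlinarith [sq_nonneg (c + 2 * d)]
        exact pow_eq_zero_iff (two_ne_zero) |>.1 (le_antisymm this (sq_nonneg c))
      have h5 : d = 0 := by
        have : d ^ 2 ≤ 0 := by nlinarith [sq_nonneg (2 * c + d)]
        exact pow_eq_zero_iff (two_ne_zero) |>.1 (le_antisymm this (sq_nonneg d))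
      apply h
      apply Prod.ext <;> omega
    exact_mod_cast this
  rw [← mul_pow] at h2
  have h3 : 1 ≤ (Ln l n : ℝ) * dist (pt q l n v) (pt q l n v') := by
    have h0 : 0 ≤ (Ln l n : ℝ) * dist (pt q l n v) (pt q l n v') := by positivity
    nlinarith
  rw [div_le_iff₀ hL]; linarith

lemma TT_dist (n : ℕ) {p v : ℕ × ℕ} (hv : IsV p v) {x : E2} (hx : x ∈ TT q l n p) :
    dist x (pt q l n v) ≤ 1 / Ln l n := by
  have hL := LnR_pos hl n
  obtain ⟨s, t, ⟨h1, h2, h3⟩, rfl⟩ := hx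
  have hd : (Ln l n : ℝ) ^ 2 * dist (Ph q s t) (pt q l n v) ^ 2 =
      (Ln l n * s - v.1) ^ 2 + (Ln l n * s - v.1) * (Ln l n * t - v.2) + (Ln l n * t - v.2) ^ 2 := by
    unfold pt
    rw [Ph_dist hq]
    field_simp
  have h4 : (Ln l n : ℝ) ^ 2 * dist (Ph q s t) (pt q l n v) ^ 2 ≤ 1 := by
    rw [hd]
    rw [mul_add] at h3
    generalize (Ln l n : ℝ) * s = X at *
    generalize (Ln l n : ℝ) * t = Y at *
    obtain ⟨a, b⟩ := p
    simp only at *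
    obtain ⟨x, rfl⟩ : ∃ x, X = a + x := ⟨X - a, by ring⟩
    obtain ⟨y, rfl⟩ : ∃ y, Y = b + y := ⟨Y - b, by ring⟩
    have hx0 : 0 ≤ x := by linarith
    have hy0 : 0 ≤ y := by linarith
    have hxy : x + y ≤ 1 := by linarith
    have hm : 0 ≤ x * y := mul_nonneg hx0 hy0
    rcases hv with rfl | rfl | rfl <;> push_cast
    · nlinarith
    · nlinarith [mul_nonneg hx0 (show 0 ≤ 1 - x - y by linarith), mul_nonneg hy0 (show 0 ≤ 1 - x - y by linarith)]
    · nlinarith [mul_nonneg hx0 (show 0 ≤ 1 - x - y by linarith), mul_nonneg hy0 (show 0 ≤ 1 - x - y by linarith)]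
  rw [← mul_pow] at h4
  have h5 : (Ln l n : ℝ) * dist (Ph q s t) (pt q l n v) ≤ 1 := by
    have h0 : 0 ≤ (Ln l n : ℝ) * dist (Ph q s t) (pt q l n v) := by positivity
    nlinarith
  rw [le_div_iff₀ hL]; linarith

end



/-! ### The geodesic distance -/

section
variable (q : Fin 3 → E2) (l : ℕ → ℕ)

lemma pdist_le {γ : ℝ → E2} {x y : E2} (hc : ContinuousOn γ (Set.Icc 0 1))
    (hm : Set.MapsTo γ (Set.Icc 0 1) (Gasket q l)) (h0 : γ 0 = x) (h1 : γ 1 = y) :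
    pdist q l x y ≤ eVariationOn γ (Set.Icc 0 1) := by
  unfold pdist
  exact iInf_le_of_le γ (iInf_le_of_le hc (iInf_le_of_le hm (iInf_le_of_le h0 (iInf_le_of_le h1 le_rfl))))

lemma le_pdist {x y : E2} {C : ℝ≥0∞} (h : ∀ γ : ℝ → E2, ContinuousOn γ (Set.Icc 0 1) →
    Set.MapsTo γ (Set.Icc 0 1) (Gasket q l) → γ 0 = x → γ 1 = y → C ≤ eVariationOn γ (Set.Icc 0 1)) :
    C ≤ pdist q l x y := by
  unfold pdist
  exact le_iInf fun γ => le_iInf fun a => le_iInf fun b => le_iInf fun c => le_iInf fun d => h γ a b c d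

lemma pdist_symm_le (x y : E2) : pdist q l y x ≤ pdist q l x y := by
  apply le_pdist
  intro γ hc hm h0 h1
  have hφ : Set.MapsTo (fun t : ℝ => 1 - t) (Set.Icc 0 1) (Set.Icc 0 1) := by
    intro t ht; exact ⟨by linarith [ht.2], by linarith [ht.1]⟩
  refine (pdist_le q l (γ := γ ∘ fun t => 1 - t) ?_ ?_ ?_ ?_).trans
    (eVariationOn.comp_le_of_antitoneOn γ (fun t : ℝ => 1 - t) ?_ hφ)
  · exact hc.comp (by fun_prop) hφ
  · exact hm.comp hφ
  · simpa using h1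
  · simpa using h0
  · intro a _ b _ hab; simp only; linarith

lemma edist_le_pdist (x y : E2) : edist x y ≤ pdist q l x y := by
  apply le_pdist
  rintro γ hc hm rfl rfl
  exact eVariationOn.edist_le γ (by simp) (by simp)

lemma pdist_triangle (x y z : E2) : pdist q l x z ≤ pdist q l x y + pdist q l y z := by
  have key : ∀ γ1 γ2 : ℝ → E2, ContinuousOn γ1 (Set.Icc 0 1) →
      Set.MapsTo γ1 (Set.Icc 0 1) (Gasket q l) → γ1 0 = x → γ1 1 = y → ContinuousOn γ2 (Set.Icc 0 1) →
      Set.MapsTo γ2 (Set.Icc 0 1) (Gasket q l) → γ2 0 = y → γ2 1 = z →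
      pdist q l x z ≤ eVariationOn γ1 (Set.Icc 0 1) + eVariationOn γ2 (Set.Icc 0 1) := by
    intro γ1 γ2 c1 m1 a0 a1 c2 m2 b0 b1
    set γ : ℝ → E2 := fun t => if t ≤ 1 / 2 then γ1 (2 * t) else γ2 (2 * t - 1) with hγ
    have hφ1 : Set.MapsTo (fun t : ℝ => 2 * t) (Set.Icc 0 (1 / 2)) (Set.Icc 0 1) := by
      intro t ht; exact ⟨by linarith [ht.1], by linarith [ht.2]⟩
    have hφ2 : Set.MapsTo (fun t : ℝ => 2 * t - 1) (Set.Icc (1 / 2) 1) (Set.Icc 0 1) := by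
      intro t ht; exact ⟨by linarith [ht.1], by linarith [ht.2]⟩
    have e1 : Set.EqOn γ (γ1 ∘ fun t => 2 * t) (Set.Icc 0 (1 / 2)) := by
      intro t ht
      simp only [hγ, Function.comp]
      rw [if_pos ht.2]
    have e2 : Set.EqOn γ (γ2 ∘ fun t => 2 * t - 1) (Set.Icc (1 / 2) 1) := by
      intro t ht
      simp only [hγ, Function.comp]
      split_ifs with h
      · obtain rfl : t = 1 / 2 := le_antisymm h ht.1
        norm_num
        rw [a1, b0]
      · rfl
    have hU : Set.Icc (0 : ℝ) 1 = Set.Icc 0 (1 / 2) ∪ Set.Icc (1 / 2) 1 :=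
      (Set.Icc_union_Icc_eq_Icc (by norm_num) (by norm_num)).symm
    have hc : ContinuousOn γ (Set.Icc 0 1) := by
      rw [hU]
      apply ContinuousOn.union_of_isClosed _ _ isClosed_Icc isClosed_Icc
      · exact ContinuousOn.congr (c1.comp (by fun_prop) hφ1) e1
      · exact ContinuousOn.congr (c2.comp (by fun_prop) hφ2) e2
    have hm : Set.MapsTo γ (Set.Icc 0 1) (Gasket q l) := by
      rw [hU]
      intro t ht
      rcases ht with ht | ht
      · rw [e1 ht]; exact m1 (hφ1 ht)
      · rw [e2 ht]; exact m2 (hφ2 ht)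
    refine (pdist_le q l hc hm ?_ ?_).trans ?_
    · rw [e1 (by constructor <;> norm_num)]; simpa using a0
    · rw [e2 (by constructor <;> norm_num)]; simp only [Function.comp]; norm_num; exact b1
    · have h := eVariationOn.Icc_add_Icc γ (s := Set.univ) (a := 0) (b := 1 / 2) (c := 1)
        (by norm_num) (by norm_num) (Set.mem_univ _)
      simp only [Set.univ_inter] at h
      rw [← h, eVariationOn.eq_of_eqOn e1, eVariationOn.eq_of_eqOn e2]
      gcongr
      · exact eVariationOn.comp_le_of_monotoneOn γ1 _ (by intro a _ b _ h; simp only; linarith) hφ1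
      · exact eVariationOn.comp_le_of_monotoneOn γ2 _ (by intro a _ b _ h; simp only; linarith) hφ2
  unfold pdist at key ⊢
  simp only [ENNReal.iInf_add, ENNReal.add_iInf]
  refine le_iInf fun γ1 => le_iInf fun a1 => le_iInf fun a2 => le_iInf fun a3 => le_iInf fun a4 => ?_
  refine le_iInf fun γ2 => le_iInf fun b1 => le_iInf fun b2 => le_iInf fun b3 => le_iInf fun b4 => ?_
  exact key γ2 γ1 b1 b2 b3 b4 a1 a2 a3 a4

lemma pdist_seg {x y : E2} (h : ∀ θ : ℝ, 0 ≤ θ → θ ≤ 1 → (1 - θ) • x + θ • y ∈ Gasket q l) :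
    pdist q l x y ≤ edist x y := by
  set γ : ℝ → E2 := fun θ => (1 - θ) • x + θ • y with hγ
  have hL : LipschitzOnWith (nndist x y) γ Set.univ := by
    apply LipschitzOnWith.of_dist_le_mul
    intro a _ b _
    have : γ a - γ b = (b - a) • (x - y) := by simp only [hγ]; module
    rw [dist_eq_norm, this, norm_smul, coe_nndist, dist_eq_norm, dist_eq_norm, mul_comm, norm_sub_rev b a]
  refine (pdist_le q l (γ := γ) (by fun_prop) (fun θ hθ => h θ hθ.1 hθ.2) (by simp [hγ]) (by simp [hγ])).trans ?_
  have h1 := hL.comp_eVariationOn_le (g := fun t : ℝ => t) (s := Set.Icc 0 1) (fun _ _ => Set.mem_univ _)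
  have h2 := MonotoneOn.eVariationOn_eq (f := fun t : ℝ => t) (s := Set.univ) (a := 0) (b := 1)
    (monotone_id.monotoneOn _) (Set.mem_univ _) (Set.mem_univ _)
  simp only [Set.univ_inter, sub_zero, ENNReal.ofReal_one] at h2
  rw [h2, mul_one] at h1
  rw [edist_nndist]
  exact h1

end

section
variable {q : Fin 3 → E2} (hq : ∀ j k : Fin 3, j ≠ k → dist (q j) (q k) = 1)
  {l : ℕ → ℕ} (hl : ∀ n, 5 ≤ l n)
include hq hl

lemma pdist_edge (n : ℕ) {p v v' : ℕ × ℕ} (hp : p ∈ PF l n) (hv : IsV p v) (hv' : IsV p v') :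
    pdist q l (pt q l n v) (pt q l n v') ≤ ENNReal.ofReal (1 / Ln l n) := by
  refine (pdist_seg q l fun θ h0 h1 => segment_mem q hl n hp hv hv' h0 h1).trans ?_
  rw [edist_dist]
  exact ENNReal.ofReal_le_ofReal (TT_dist hq hl n hv' (pt_mem_TT q hl n hv))

lemma pdist_chain (n : ℕ) (N : ℕ) (c v : ℕ → ℕ × ℕ)
    (h : ∀ t < N, c t ∈ PF l n ∧ IsV (c t) (v t) ∧ IsV (c t) (v (t + 1)))
    (h0 : pt q l n (v 0) ∈ Gasket q l) :
    pdist q l (pt q l n (v 0)) (pt q l n (v N)) ≤ ENNReal.ofReal (N / Ln l n) := by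
  have hL := LnR_pos hl n
  induction N with
  | zero =>
    refine (pdist_seg q l fun θ t0 t1 => ?_).trans ?_
    · rw [← add_smul]; simpa using h0
    · simp
  | succ N ih =>
    refine (pdist_triangle q l _ (pt q l n (v N)) _).trans ?_
    have h1 := ih fun t ht => h t (by omega)
    have h2 := h N (by omega)
    refine (add_le_add h1 (pdist_edge hq hl n h2.1 h2.2.1 h2.2.2)).trans ?_
    rw [← ENNReal.ofReal_add (by positivity) (by positivity)]
    apply ENNReal.ofReal_le_ofReal
    push_cast
    rw [add_div]

lemma pdist_desc (k : ℕ) : ∀ n p x v, p ∈ PF l n → Desc l k n p x → IsV p v →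
    pdist q l (pt q l n v) (pt q l (n + k) x) ≤ ENNReal.ofReal ((3 / 2) / Ln l n) := by
  induction k with
  | zero =>
    intro n p x v hp hx hv
    have hL := LnR_pos hl n
    refine (pdist_edge hq hl n hp hv hx).trans (ENNReal.ofReal_le_ofReal ?_)
    gcongr
    norm_num
  | succ k ih =>
    intro n p x v hp hx hv
    obtain ⟨i, hi, hx⟩ := hx
    have hL := LnR_pos hl n
    have h5 := hl n
    have hm : (0 : ℝ) < l n := by positivity
    have key : ∃ κ, (κ = (0, 0) ∨ κ = (l n, 0) ∨ κ = (0, l n)) ∧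
        pt q l (n + 1) (child (l n) p κ) = pt q l n v := by
      rcases hv with rfl | rfl | rfl
      · exact ⟨_, Or.inl rfl, pt_scale q hl n v.1 v.2⟩
      · exact ⟨_, Or.inr (Or.inl rfl), pt_scale q hl n (p.1 + 1) p.2⟩
      · exact ⟨_, Or.inr (Or.inr rfl), pt_scale q hl n p.1 (p.2 + 1)⟩
    obtain ⟨κ, hκ, hv'⟩ := key
    obtain ⟨N, c, w, hN, hw0, hwN, hc, -⟩ := path_exists (hl n) hi hκ
    have isv : ∀ j w, IsV j w → IsV (child (l n) p j) (child (l n) p w) := by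
      intro j w hw
      rcases hw with rfl | rfl | rfl
      · exact Or.inl rfl
      · exact Or.inr (Or.inl rfl)
      · exact Or.inr (Or.inr rfl)
    have hK : pt q l n v ∈ Gasket q l := pt_mem_Gasket q hl n hp hv
    have h1 := pdist_chain hq hl (n + 1) N (fun t => child (l n) p (c t)) (fun t => child (l n) p (w t))
      (fun t ht => ⟨mem_PF_succ.2 ⟨p, hp, c t, (hc t ht).1, rfl⟩, isv _ _ (hc t ht).2.2.1,
        isv _ _ (hc t ht).2.2.2⟩) (by simp only [hw0, hv']; exact hK)
    have h2 := ih (n + 1) _ x _ (mem_PF_succ.2 ⟨p, hp, i, hi, rfl⟩) hx (isv _ _ hwN)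
    simp only [hw0, hv'] at h1
    rw [show n + (k + 1) = n + 1 + k by ring]
    refine (pdist_triangle q l _ _ _).trans ((add_le_add h1 h2).trans ?_)
    have hL1 := LnR_pos hl (n + 1)
    rw [← ENNReal.ofReal_add (by positivity) (by positivity)]
    apply ENNReal.ofReal_le_ofReal
    have hN' : ((2 * N + 3 : ℕ) : ℝ) ≤ ((3 * l n : ℕ) : ℝ) := by
      have : 2 * N + 3 ≤ 3 * l n := by omega
      exact_mod_cast this
    push_cast at hN'
    rw [← add_div, LnR_succ, div_le_div_iff₀ (by positivity) hL]
    have : (N + 3 / 2 : ℝ) * Ln l n ≤ (3 / 2 * l n) * Ln l n := by gcongr; linarith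
    linarith

/-- Paths between cells without a common vertex are long. -/
lemma pdist_lower (n : ℕ) {p p' : ℕ × ℕ} (hp : p ∈ PF l n) (hp' : p' ∈ PF l n)
    (hne : ∀ v, IsV p v → ¬ IsV p' v) {x y : E2}
    (hx : x ∈ TT q l n p) (hy : y ∈ TT q l n p') : ENNReal.ofReal (1 / Ln l n) ≤ pdist q l x y := by
  apply le_pdist
  rintro γ hc hm rfl rfl
  have hpp : p ≠ p' := by
    rintro rfl; exact hne p (Or.inl rfl) (Or.inl rfl)
  have hconn : IsPreconnected (γ '' Set.Icc 0 1) := isPreconnected_Icc.image γ hc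
  rw [isPreconnected_closed_iff] at hconn
  have main : ∀ r ∈ PF l n, ∀ r' ∈ PF l n, r ≠ r' → (γ '' Set.Icc 0 1 ∩ TT q l n r).Nonempty →
      (γ '' Set.Icc 0 1 ∩ TT q l n r').Nonempty → ∃ t ∈ Set.Icc (0 : ℝ) 1, ∃ v, IsV r v ∧ γ t = pt q l n v := by
    intro r hr r' hr' hrr h1 h2
    have hcl : IsClosed (⋃ s ∈ (PF l n).erase r, TT q l n s) :=
      ((PF l n).erase r).finite_toSet.isClosed_biUnion fun s hs =>
        (TT_compact q hl n (Finset.mem_of_mem_erase hs)).isClosed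
    have := hconn (TT q l n r) (⋃ s ∈ (PF l n).erase r, TT q l n s) (TT_compact q hl n hr).isClosed hcl ?_ h1 ?_
    · obtain ⟨z, ⟨t, ht, rfl⟩, hz1, hz2⟩ := this
      simp only [Set.mem_iUnion, exists_prop] at hz2
      obtain ⟨s, hs, hz2⟩ := hz2
      obtain ⟨v, hv, -, he⟩ := TT_inter hq hl n (Finset.ne_of_mem_erase hs).symm hz1 hz2
      exact ⟨t, ht, v, hv, he⟩
    · rintro z ⟨t, ht, rfl⟩
      obtain ⟨s, hs, hz⟩ := (mem_Gasket q hl _).1 (hm ht) n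
      by_cases hsr : s = r
      · left; rwa [← hsr]
      · right
        simp only [Set.mem_iUnion, exists_prop]
        exact ⟨s, Finset.mem_erase.2 ⟨hsr, hs⟩, hz⟩
    · obtain ⟨z, hz1, hz2⟩ := h2
      refine ⟨z, hz1, ?_⟩
      simp only [Set.mem_iUnion, exists_prop]
      exact ⟨r', Finset.mem_erase.2 ⟨hrr.symm, hr'⟩, hz2⟩
  have n1 : (γ '' Set.Icc 0 1 ∩ TT q l n p).Nonempty := ⟨γ 0, ⟨0, by simp, rfl⟩, hx⟩
  have n2 : (γ '' Set.Icc 0 1 ∩ TT q l n p').Nonempty := ⟨γ 1, ⟨1, by simp, rfl⟩, hy⟩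
  obtain ⟨t, ht, v, hv, e⟩ := main p hp p' hp' hpp n1 n2
  obtain ⟨t', ht', v', hv', e'⟩ := main p' hp' p hp hpp.symm n2 n1
  refine le_trans ?_ (eVariationOn.edist_le γ ht ht')
  rw [e, e', edist_dist]
  apply ENNReal.ofReal_le_ofReal
  apply pt_dist_ge hq hl
  rintro rfl
  exact hne v hv hv'

end



/-! ### Harmonic extension as a function on the plane -/

section
variable {q : Fin 3 → E2} (hq : ∀ j k : Fin 3, j ≠ k → dist (q j) (q k) = 1)
  {l : ℕ → ℕ} (hl : ∀ n, 5 ≤ l n)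
include hq hl

lemma pt_inj (n : ℕ) {v w : ℕ × ℕ} (h : pt q l n v = pt q l n w) : v = w := by
  have hL := LnR_pos hl n
  obtain ⟨h1, h2⟩ := Ph_inj hq h
  rw [div_left_inj' hL.ne'] at h1 h2
  exact Prod.ext (by exact_mod_cast h1) (by exact_mod_cast h2)

omit hq in
lemma HX_up (N : ℕ) (U0 : ℕ × ℕ → ℝ) (k j : ℕ) : ∃ m : ℕ, ∀ a b,
    pt q l (N + (k + j)) (m * a, m * b) = pt q l (N + k) (a, b) ∧
    HX l N U0 (k + j) (m * a, m * b) = HX l N U0 k (a, b) := by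
  induction j with
  | zero => exact ⟨1, fun a b => by simp⟩
  | succ j ih =>
    obtain ⟨m, hm⟩ := ih
    refine ⟨l (N + (k + j)) * m, fun a b => ?_⟩
    rw [mul_assoc, mul_assoc]
    constructor
    · rw [← (hm a b).1]; exact pt_scale q hl (N + (k + j)) (m * a) (m * b)
    · rw [← (hm a b).2]; exact HX_compat hl N U0 (k + j) (m * a) (m * b)

lemma HX_consistent (N : ℕ) (U0 : ℕ × ℕ → ℝ) (k k' : ℕ) (v v' : ℕ × ℕ)
    (h : pt q l (N + k) v = pt q l (N + k') v') : HX l N U0 k v = HX l N U0 k' v' := by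
  obtain ⟨m, hm⟩ := HX_up (q := q) hl N U0 k k'
  obtain ⟨m', hm'⟩ := HX_up (q := q) hl N U0 k' k
  have h1 := hm v.1 v.2
  have h2 := hm' v'.1 v'.2
  rw [add_comm k' k] at h2
  have h3 : pt q l (N + (k + k')) (m * v.1, m * v.2) = pt q l (N + (k + k')) (m' * v'.1, m' * v'.2) := by
    rw [h1.1, h2.1]; exact h
  have h4 := pt_inj hq hl _ h3
  calc HX l N U0 k v = _ := h1.2.symm
    _ = _ := by rw [h4]
    _ = _ := h2.2

lemma exists_HX (N : ℕ) (U0 : ℕ × ℕ → ℝ) : ∃ u : E2 → ℝ, ∀ k, lat q l u (N + k) = HX l N U0 k := by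
  classical
  refine ⟨fun z => if h : ∃ s : ℕ × (ℕ × ℕ), z = pt q l (N + s.1) s.2 then
    HX l N U0 h.choose.1 h.choose.2 else 0, fun k => ?_⟩
  funext v
  have h : ∃ s : ℕ × (ℕ × ℕ), pt q l (N + k) v = pt q l (N + s.1) s.2 := ⟨(k, v), rfl⟩
  simp only [lat]
  rw [dif_pos h]
  exact (HX_consistent hq hl N U0 _ _ _ _ h.choose_spec).symm

end

/-! ### The energy form and the resistance metric -/

section
variable (q : Fin 3 → E2) {l : ℕ → ℕ} (hl : ∀ n, 5 ≤ l n)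
include hl

lemma EForm_tendsto {u : E2 → ℝ} (hu : u ∈ FDom q l) :
    Tendsto (EL l (lat q l u)) atTop (nhds (EForm q l u u)) := by
  obtain ⟨C, hC⟩ := hu
  have h1 : (fun n => En q l n u u) = EL l (lat q l u) := by funext n; exact En_eq q hl n u
  have hb : BddAbove (Set.range (EL l (lat q l u))) := by
    refine ⟨C, ?_⟩
    rintro _ ⟨n, rfl⟩
    rw [← En_eq q hl n u]; exact hC n
  have h2 := tendsto_atTop_ciSup (EL_mono hl (lat_compat q hl u)) hb
  unfold EForm
  rw [h1, h2.limUnder_eq]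
  exact h2

lemma EL_le_EForm {u : E2 → ℝ} (hu : u ∈ FDom q l) (n : ℕ) : EL l (lat q l u) n ≤ EForm q l u u :=
  (EL_mono hl (lat_compat q hl u)).ge_of_tendsto (EForm_tendsto q hl hu) n

lemma EL_nonneg (U : ℕ → ℕ × ℕ → ℝ) (n : ℕ) : 0 ≤ EL l U n :=
  mul_nonneg (inv_nonneg.2 (Rn_pos hl n).le) (Finset.sum_nonneg fun _ _ => ec3_nonneg _ _ _)

lemma EForm_nonneg {u : E2 → ℝ} (hu : u ∈ FDom q l) : 0 ≤ EForm q l u u :=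
  (EL_nonneg hl _ 0).trans (EL_le_EForm q hl hu 0)

lemma FDom_of_EL {u : E2 → ℝ} {C : ℝ} (h : ∀ n, EL l (lat q l u) n ≤ C) : u ∈ FDom q l :=
  ⟨C, fun n => by rw [En_eq q hl n u]; exact h n⟩

lemma osc_desc {u : E2 → ℝ} (hu : u ∈ FDom q l) {n k : ℕ} {p x v : ℕ × ℕ} (hp : p ∈ PF l n)
    (hx : Desc l k n p x) (hv : IsV p v) :
    (u (pt q l (n + k) x) - u (pt q l n v)) ^ 2 ≤ 2 * Rn l n * EForm q l u u := by
  have h1 := desc_bound hl (lat_compat q hl u) k n p x v hx hv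
  have h2 := Eloc_le hl (lat_compat q hl u) k n hp
  have h3 := EL_le_EForm q hl hu (n + k)
  have h4 := mul_le_mul_of_nonneg_left h3 (Rn_pos hl n).le
  unfold lat at h1 h2 h4
  linarith

lemma RE_bdd {x y : E2} (hx : x ∈ Vstar q l) (hy : y ∈ Vstar q l) : BddAbove (REset q l x y) := by
  refine ⟨8, ?_⟩
  rintro _ ⟨u, hu, hE, rfl⟩
  obtain ⟨p, hp, k, v, hv, rfl⟩ := Vstar_desc q hl hx 0
  obtain ⟨p', hp', k', v', hv', rfl⟩ := Vstar_desc q hl hy 0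
  have e1 : p = (0, 0) := by simpa [PF] using hp
  have e2 : p' = (0, 0) := by simpa [PF] using hp'
  subst e1; subst e2
  have h1 := osc_desc q hl hu hp hv (Or.inl rfl)
  have h2 := osc_desc q hl hu hp hv' (Or.inl rfl)
  have h3 : Rn l 0 = 1 := by simp [Rn]
  rw [h3] at h1 h2
  rw [div_le_iff₀ hE]
  nlinarith [sq_nonneg (u (pt q l (0 + k) v) - u (pt q l 0 (0, 0)) + (u (pt q l (0 + k') v') - u (pt q l 0 (0, 0))))]

lemma le_RE {x y : E2} (hx : x ∈ Vstar q l) (hy : y ∈ Vstar q l) {u : E2 → ℝ} (hu : u ∈ FDom q l) :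
    (u x - u y) ^ 2 ≤ RE q l x y * EForm q l u u := by
  rcases (EForm_nonneg q hl hu).lt_or_eq with hE | hE
  · rw [← div_le_iff₀ hE]
    exact le_csSup (RE_bdd q hl hx hy) ⟨u, hu, hE, rfl⟩
  · rw [← hE, mul_zero]
    obtain ⟨p, hp, k, v, hv, rfl⟩ := Vstar_desc q hl hx 0
    obtain ⟨p', hp', k', v', hv', rfl⟩ := Vstar_desc q hl hy 0
    have e1 : p = (0, 0) := by simpa [PF] using hp
    have e2 : p' = (0, 0) := by simpa [PF] using hp'
    subst e1; subst e2
    have h1 := osc_desc q hl hu hp hv (Or.inl rfl)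
    have h2 := osc_desc q hl hu hp hv' (Or.inl rfl)
    rw [← hE, mul_zero] at h1 h2
    nlinarith [sq_nonneg (u (pt q l (0 + k) v) - u (pt q l 0 (0, 0)) + (u (pt q l (0 + k') v') - u (pt q l 0 (0, 0))))]

omit hl in
lemma RE_le {x y : E2} {C : ℝ} (hC : 0 ≤ C)
    (h : ∀ u ∈ FDom q l, (u x - u y) ^ 2 ≤ C * EForm q l u u) : RE q l x y ≤ C := by
  apply Real.sSup_le _ hC
  rintro _ ⟨u, hu, hE, rfl⟩
  rw [div_le_iff₀ hE]; exact h u hu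

omit hl in
lemma RE_nonneg (x y : E2) : 0 ≤ RE q l x y := by
  apply Real.sSup_nonneg
  rintro _ ⟨u, hu, hE, rfl⟩
  positivity

omit hl in
lemma RE_self (x : E2) : RE q l x x = 0 :=
  le_antisymm (RE_le q le_rfl fun u hu => by simp) (RE_nonneg q x x)

omit hl in
lemma RE_symm (x y : E2) : RE q l x y = RE q l y x := by
  unfold RE REset
  congr 1
  ext t
  constructor
  all_goals
    rintro ⟨u, hu, hE, rfl⟩
    exact ⟨u, hu, hE, by ring⟩

lemma RE_near {n k : ℕ} {p z v : ℕ × ℕ} (hp : p ∈ PF l n)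
    (hx : Desc l k n p z) (hv : IsV p v) : RE q l (pt q l (n + k) z) (pt q l n v) ≤ 2 * Rn l n :=
  RE_le q (by have := Rn_pos hl n; positivity) fun u hu => osc_desc q hl hu hp hx hv

omit hl in
lemma cut2 (a b c : ℝ) :
    (max a c - max b c) ^ 2 + (min a c - min b c) ^ 2 ≤ (a - b) ^ 2 := by
  rcases le_total a c with h1 | h1 <;> rcases le_total b c with h2 | h2 <;> simp only [h1, h2, max_eq_left, max_eq_right, min_eq_left, min_eq_right] <;> nlinarith

lemma EL_cut (u : E2 → ℝ) (c : ℝ) (n : ℕ) :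
    EL l (lat q l (fun z => max (u z) c)) n + EL l (lat q l (fun z => min (u z) c)) n ≤ EL l (lat q l u) n := by
  unfold EL
  rw [← mul_add, ← Finset.sum_add_distrib]
  apply mul_le_mul_of_nonneg_left _ (inv_nonneg.2 (Rn_pos hl n).le)
  apply Finset.sum_le_sum
  intro p _
  simp only [ec, ec3, lat]
  have h1 := cut2 (u (pt q l n p)) (u (pt q l n (p.1 + 1, p.2))) c
  have h2 := cut2 (u (pt q l n p)) (u (pt q l n (p.1, p.2 + 1))) c
  have h3 := cut2 (u (pt q l n (p.1 + 1, p.2))) (u (pt q l n (p.1, p.2 + 1))) c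
  linarith

lemma EForm_cut {u : E2 → ℝ} (hu : u ∈ FDom q l) (c : ℝ) :
    (fun z => max (u z) c) ∈ FDom q l ∧ (fun z => min (u z) c) ∈ FDom q l ∧
    EForm q l (fun z => max (u z) c) (fun z => max (u z) c) +
      EForm q l (fun z => min (u z) c) (fun z => min (u z) c) ≤ EForm q l u u := by
  have h1 : (fun z => max (u z) c) ∈ FDom q l := FDom_of_EL q hl (C := EForm q l u u) fun n => by
    linarith [EL_cut q hl u c n, EL_le_EForm q hl hu n, EL_nonneg hl (lat q l (fun z => min (u z) c)) n]
  have h2 : (fun z => min (u z) c) ∈ FDom q l := FDom_of_EL q hl (C := EForm q l u u) fun n => by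
    linarith [EL_cut q hl u c n, EL_le_EForm q hl hu n, EL_nonneg hl (lat q l (fun z => max (u z) c)) n]
  refine ⟨h1, h2, ?_⟩
  exact le_of_tendsto_of_tendsto' ((EForm_tendsto q hl h1).add (EForm_tendsto q hl h2))
    (EForm_tendsto q hl hu) fun n => EL_cut q hl u c n

omit hl in
lemma cs2 {a b A B e f : ℝ} (hA : 0 ≤ A) (hB : 0 ≤ B) (he : 0 ≤ e) (hf : 0 ≤ f)
    (ha : a ^ 2 ≤ A * e) (hb : b ^ 2 ≤ B * f) : (a + b) ^ 2 ≤ (A + B) * (e + f) := by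
  have h1 : (a * b) ^ 2 ≤ (A * f) * (B * e) := by
    have := mul_le_mul ha hb (sq_nonneg b) (by positivity)
    nlinarith
  have h2 : 2 * (a * b) ≤ A * f + B * e := by
    refine le_of_abs_le (abs_le_of_sq_le_sq ?_ (by positivity))
    nlinarith [sq_nonneg (A * f - B * e)]
  nlinarith

lemma RE_triangle {x y z : E2} (hx : x ∈ Vstar q l) (hy : y ∈ Vstar q l) (hz : z ∈ Vstar q l) :
    RE q l x z ≤ RE q l x y + RE q l y z := by
  have n1 := RE_nonneg (l := l) q x y
  have n2 := RE_nonneg (l := l) q y z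
  apply RE_le q (by positivity)
  intro u hu
  have hE := EForm_nonneg q hl hu
  obtain ⟨m1, m2, hc⟩ := EForm_cut q hl hu (u y)
  have e1 := EForm_nonneg q hl m1
  have e2 := EForm_nonneg q hl m2
  have key : ∀ {A B : ℝ}, (u x - u z) ^ 2 ≤ (RE q l x y + RE q l y z) * (A + B) → A + B ≤ EForm q l u u →
      (u x - u z) ^ 2 ≤ (RE q l x y + RE q l y z) * EForm q l u u := fun h1 h2 =>
    h1.trans (mul_le_mul_of_nonneg_left h2 (by positivity))
  have hxy := le_RE q hl hx hy hu
  have hyz := le_RE q hl hy hz hu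
  have p1 := mul_nonneg n1 hE
  have p2 := mul_nonneg n2 hE
  rcases le_total (u x) (u y) with h1 | h1 <;> rcases le_total (u z) (u y) with h2 | h2
  · rcases le_total (u x) (u z) with h3 | h3
    · nlinarith
    · nlinarith
  · have a := le_RE q hl hx hy m2
    have b := le_RE q hl hy hz m1
    simp only [h1, h2, max_eq_left, max_eq_right, min_eq_left, min_eq_right, min_self, max_self] at a b
    have := cs2 n1 n2 e2 e1 a b
    refine key (A := EForm q l (fun z => min (u z) (u y)) (fun z => min (u z) (u y))) (B := EForm q l (fun z => max (u z) (u y)) (fun z => max (u z) (u y))) ?_ (by linarith)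
    convert this using 2; ring
  · have a := le_RE q hl hx hy m1
    have b := le_RE q hl hy hz m2
    simp only [h1, h2, max_eq_left, max_eq_right, min_eq_left, min_eq_right, min_self, max_self] at a b
    have := cs2 n1 n2 e1 e2 a b
    refine key ?_ hc
    convert this using 2; ring
  · rcases le_total (u x) (u z) with h3 | h3
    · nlinarith
    · nlinarith

end



section
variable {q : Fin 3 → E2} (hq : ∀ j k : Fin 3, j ≠ k → dist (q j) (q k) = 1)
  {l : ℕ → ℕ} (hl : ∀ n, 5 ≤ l n)
include hq hl

lemma far_RE (n k k' : ℕ) {p p' z z' : ℕ × ℕ} (hp : p ∈ PF l n) (hp' : p' ∈ PF l n)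
    (hz : Desc l k n p z) (hz' : Desc l k' n p' z') (hne : ∀ v, IsV p v → ¬ IsV p' v)
    (hx : pt q l (n + k) z ∈ Vstar q l) (hy : pt q l (n + k') z' ∈ Vstar q l) :
    Rn l n / 6 ≤ RE q l (pt q l (n + k) z) (pt q l (n + k') z') := by
  classical
  have hR := Rn_pos hl n
  obtain ⟨u, hu⟩ := exists_HX hq hl n (fun v => if IsV p v then (1 : ℝ) else 0)
  have hloc : ∀ k p1, Eloc l (lat q l u) k n p1 = ec (fun v => if IsV p v then (1 : ℝ) else 0) p1 :=
    fun k p1 => HX_Eloc hl n _ hu k 0 p1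
  have hEL : ∀ k, EL l (lat q l u) (n + k) ≤ 6 / Rn l n := by
    intro k
    rw [← sum_Eloc hl k n]
    simp only [hloc]
    have := indicator_energy hl n hp
    rw [div_eq_inv_mul]
    apply mul_le_mul_of_nonneg_left _ (inv_nonneg.2 hR.le)
    convert this
  have hEL' : ∀ m, EL l (lat q l u) m ≤ 6 / Rn l n := fun m =>
    (EL_mono hl (lat_compat q hl u) (by omega : m ≤ n + m)).trans (hEL m)
  have hF : u ∈ FDom q l := FDom_of_EL q hl hEL'
  have hEF : EForm q l u u ≤ 6 / Rn l n := le_of_tendsto' (EForm_tendsto q hl hF) hEL'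
  have hun : ∀ v, u (pt q l n v) = if IsV p v then (1 : ℝ) else 0 := fun v => congrFun (hu 0) v
  have h1 := desc_bound hl (lat_compat q hl u) k n p z p hz (Or.inl rfl)
  have h2 := desc_bound hl (lat_compat q hl u) k' n p' z' p' hz' (Or.inl rfl)
  rw [hloc] at h1 h2
  have v0 : IsV p p := Or.inl rfl
  have v1 : IsV p (p.1 + 1, p.2) := Or.inr (Or.inl rfl)
  have v2 : IsV p (p.1, p.2 + 1) := Or.inr (Or.inr rfl)
  have w0 : ¬ IsV p p' := fun h => hne _ h (Or.inl rfl)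
  have w1 : ¬ IsV p (p'.1 + 1, p'.2) := fun h => hne _ h (Or.inr (Or.inl rfl))
  have w2 : ¬ IsV p (p'.1, p'.2 + 1) := fun h => hne _ h (Or.inr (Or.inr rfl))
  simp only [ec, ec3, v0, v1, v2, w0, w1, w2, if_true, if_false, lat, hun] at h1 h2
  have e1 : u (pt q l (n + k) z) = 1 := by nlinarith
  have e2 : u (pt q l (n + k') z') = 0 := by nlinarith
  have h3 := le_RE q hl hx hy hF
  rw [e1, e2] at h3
  have h4 := mul_le_mul_of_nonneg_left hEF (RE_nonneg (l := l) q (pt q l (n + k) z) (pt q l (n + k') z'))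
  have h5 : 1 ≤ RE q l (pt q l (n + k) z) (pt q l (n + k') z') * (6 / Rn l n) := by linarith
  rw [← mul_div_assoc, le_div_iff₀ hR] at h5
  linarith

/-- At each level, two points of `V_*` are either close or far from each other. -/
lemma dichotomy {x y : E2} (hx : x ∈ Vstar q l) (hy : y ∈ Vstar q l) (n : ℕ) :
    (RE q l x y ≤ 4 * Rn l n ∧ pdist q l x y ≤ ENNReal.ofReal (3 / Ln l n)) ∨
    (Rn l n / 6 ≤ RE q l x y ∧ ENNReal.ofReal (1 / Ln l n) ≤ pdist q l x y ∧
      3 / 4 ≤ (Ln l n : ℝ) ^ 2 * dist x y ^ 2 ∧ 1 ≤ n) := by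
  have hL := LnR_pos hl n
  have hR := Rn_pos hl n
  have hx0 := hx
  have hy0 := hy
  obtain ⟨p, hp, k, z, hz, rfl⟩ := Vstar_desc q hl hx n
  obtain ⟨p', hp', k', z', hz', rfl⟩ := Vstar_desc q hl hy n
  by_cases hne : ∀ v, IsV p v → ¬ IsV p' v
  · right
    refine ⟨far_RE hq hl n k k' hp hp' hz hz' hne hx0 hy0,
      pdist_lower hq hl n hp hp' hne (desc_mem_TT q hl k n p z hz) (desc_mem_TT q hl k' n p' z' hz'),
      TT_sep hq hl n hne (desc_mem_TT q hl k n p z hz) (desc_mem_TT q hl k' n p' z' hz'), ?_⟩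
    by_contra h
    obtain rfl : n = 0 := by omega
    have e1 : p = (0, 0) := by simpa [PF] using hp
    have e2 : p' = (0, 0) := by simpa [PF] using hp'
    subst e1; subst e2
    exact hne _ (Or.inl rfl) (Or.inl rfl)
  · left
    push Not at hne
    obtain ⟨v, hv, hv'⟩ := hne
    have hvs : pt q l n v ∈ Vstar q l := Set.mem_iUnion.2 ⟨n, (mem_Vn q hl _ n).2 ⟨p, hp, v, hv, rfl⟩⟩
    constructor
    · have h1 := RE_near q hl hp hz hv
      have h2 := RE_near q hl hp' hz' hv'
      rw [RE_symm] at h2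
      have h3 := RE_triangle q hl hx0 hvs hy0
      linarith
    · have h1 := pdist_desc hq hl k n p z v hp hz hv
      have h2 := pdist_desc hq hl k' n p' z' v hp' hz' hv'
      have h3 := pdist_triangle q l (pt q l (n + k) z) (pt q l n v) (pt q l (n + k') z')
      have h4 := pdist_symm_le q l (pt q l n v) (pt q l (n + k) z)
      refine h3.trans ((add_le_add (h4.trans h1) h2).trans ?_)
      rw [← ENNReal.ofReal_add (by positivity) (by positivity)]
      apply ENNReal.ofReal_le_ofReal
      rw [← add_div]; norm_num

lemma pdist_ne_top {x y : E2} (hx : x ∈ Vstar q l) (hy : y ∈ Vstar q l) : pdist q l x y ≠ ⊤ := by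
  rcases dichotomy hq hl hx hy 0 with h | h
  · exact (h.2.trans_lt ENNReal.ofReal_lt_top).ne
  · omega

lemma part1 {x y : E2} (hx : x ∈ Vstar q l) (hy : y ∈ Vstar q l) (n : ℕ) :
    (gdist q l x y < ((Ln l n : ℝ))⁻¹ → RE q l x y ≤ 4 * Rn l n) ∧
    (RE q l x y < Rn l n / 6 → gdist q l x y ≤ 3 / (Ln l n : ℝ)) := by
  have hL := LnR_pos hl n
  have ht := pdist_ne_top hq hl hx hy
  rcases dichotomy hq hl hx hy n with h | h
  · refine ⟨fun _ => h.1, fun _ => ?_⟩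
    exact ENNReal.toReal_le_of_le_ofReal (by positivity) h.2
  · refine ⟨fun h1 => ?_, fun h1 => absurd h.1 (not_le.2 h1)⟩
    exfalso
    have h2 := (ENNReal.ofReal_le_iff_le_toReal ht).1 h.2.1
    unfold gdist at h1
    rw [one_div] at h2
    linarith

lemma dist_le_gdist {x y : E2} (hx : x ∈ Vstar q l) (hy : y ∈ Vstar q l) : dist x y ≤ gdist q l x y := by
  have h := edist_le_pdist q l x y
  rw [edist_dist] at h
  exact (ENNReal.ofReal_le_iff_le_toReal (pdist_ne_top hq hl hx hy)).1 h

omit hq in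
lemma Rn_le_pow (n : ℕ) : Rn l n ≤ (1 / 2) ^ n := by
  induction n with
  | zero => simp [Rn]
  | succ n ih =>
    rw [Rn_succ, pow_succ]
    have h5 := hl n
    have : rl (l n) ≤ 1 / 2 := by
      obtain ⟨k, hk⟩ := Nat.exists_eq_add_of_le' h5
      rw [hk, rl_eq, div_le_div_iff₀ (by positivity) (by norm_num)]
      have : (0 : ℝ) ≤ k := by positivity
      linarith
    exact mul_le_mul ih this (rl_pos h5).le (by positivity)

omit hq in
lemma Ln_ge_pow (n : ℕ) : (2 : ℝ) ^ n ≤ Ln l n := by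
  induction n with
  | zero => simp [Ln]
  | succ n ih =>
    rw [LnR_succ, pow_succ]
    have h5 : (5 : ℝ) ≤ l n := by exact_mod_cast hl n
    exact mul_le_mul ih (by linarith) (by norm_num) (LnR_pos hl n).le

omit hq in
lemma Rn_small {ε : ℝ} (hε : 0 < ε) : ∃ n, Rn l n < ε := by
  obtain ⟨n, hn⟩ := exists_pow_lt_of_lt_one hε (by norm_num : (1 / 2 : ℝ) < 1)
  exact ⟨n, (Rn_le_pow hl n).trans_lt hn⟩

omit hq in
lemma Ln_inv_small {ε : ℝ} (hε : 0 < ε) : ∃ n, 1 / (Ln l n : ℝ) < ε := by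
  obtain ⟨n, hn⟩ := exists_pow_lt_of_lt_one hε (by norm_num : (1 / 2 : ℝ) < 1)
  refine ⟨n, lt_of_le_of_lt ?_ hn⟩
  rw [one_div, one_div, inv_pow]
  exact inv_anti₀ (by positivity) (Ln_ge_pow hl n)

/-- Euclidean closeness implies `RE` closeness. -/
lemma RE_unif {ε : ℝ} (hε : 0 < ε) : ∃ δ > 0, ∀ x ∈ Vstar q l, ∀ y ∈ Vstar q l, dist x y < δ → RE q l x y < ε := by
  obtain ⟨n, hn⟩ := Rn_small hl (ε := ε / 4) (by positivity)
  have hL := LnR_pos hl n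
  refine ⟨1 / (2 * Ln l n), by positivity, fun x hx y hy h => ?_⟩
  rcases dichotomy hq hl hx hy n with h1 | h1
  · linarith [h1.1]
  · exfalso
    have h2 := h1.2.2.1
    rw [lt_div_iff₀ (by positivity)] at h
    have h3 := mul_nonneg hL.le (dist_nonneg (x := x) (y := y))
    nlinarith

/-- `RE` closeness implies Euclidean closeness. -/
lemma dist_unif {ε : ℝ} (hε : 0 < ε) : ∃ δ > 0, ∀ x ∈ Vstar q l, ∀ y ∈ Vstar q l, RE q l x y < δ → dist x y < ε := by
  obtain ⟨n, hn⟩ := Ln_inv_small hl (ε := ε / 3) (by positivity)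
  have hR := Rn_pos hl n
  refine ⟨Rn l n / 6, by positivity, fun x hx y hy h => ?_⟩
  have h1 := (part1 hq hl hx hy n).2 h
  have h2 := dist_le_gdist hq hl hx hy
  have h3 : 3 / (Ln l n : ℝ) = 3 * (1 / Ln l n) := by ring
  linarith

lemma Vstar_dense {x : E2} (hx : x ∈ Gasket q l) {ε : ℝ} (hε : 0 < ε) : ∃ y ∈ Vstar q l, dist x y < ε := by
  obtain ⟨n, hn⟩ := Ln_inv_small hl hε
  obtain ⟨p, hp, hxp⟩ := (mem_Gasket q hl x).1 hx n
  exact ⟨pt q l n p, Set.mem_iUnion.2 ⟨n, (mem_Vn q hl _ n).2 ⟨p, hp, p, Or.inl rfl, rfl⟩⟩,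
    (TT_dist hq hl n (Or.inl rfl) hxp).trans_lt hn⟩

end



lemma dense_forall {X : Type*} [TopologicalSpace X] {s : Set X} (hs : Dense s) {P : X → Prop}
    (hc : IsClosed {x | P x}) (h : ∀ x ∈ s, P x) (x : X) : P x :=
  closure_minimal (t := {x | P x}) h hc (hs x)

section
variable {q : Fin 3 → E2} (hq : ∀ j k : Fin 3, j ≠ k → dist (q j) (q k) = 1)
  {l : ℕ → ℕ} (hl : ∀ n, 5 ≤ l n)

/-- `V_*` as a subset of `K`. -/
def DV (q : Fin 3 → E2) (l : ℕ → ℕ) : Set ↥(Gasket q l) := {x | (x : E2) ∈ Vstar q l}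

include hq hl

lemma DV_dense : Dense (DV q l) := by
  rw [Metric.dense_iff]
  intro x r hr
  obtain ⟨y, hy, hxy⟩ := Vstar_dense hq hl x.2 hr
  exact ⟨⟨y, Vstar_sub q hl hy⟩, by rw [Metric.mem_ball, dist_comm]; exact hxy, hy⟩

lemma RE_quad {x y x' y' : E2} (hx : x ∈ Vstar q l) (hy : y ∈ Vstar q l) (hx' : x' ∈ Vstar q l)
    (hy' : y' ∈ Vstar q l) : |RE q l x y - RE q l x' y'| ≤ RE q l x x' + RE q l y y' := by
  have h1 := RE_triangle q hl hx hx' hy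
  have h2 := RE_triangle q hl hx' hy' hy
  have h3 := RE_triangle q hl hx' hx hy'
  have h4 := RE_triangle q hl hx hy hy'
  have h5 := RE_symm (l := l) q y' y
  have h6 := RE_symm (l := l) q x' x
  rw [abs_le]
  constructor <;> linarith

lemma ext_exists : ∃ Rbar : ↥(Gasket q l) → ↥(Gasket q l) → ℝ,
      Continuous (fun p : ↥(Gasket q l) × ↥(Gasket q l) => Rbar p.1 p.2) ∧
      ∀ x y : ↥(Gasket q l), (x : E2) ∈ Vstar q l → (y : E2) ∈ Vstar q l →
        Rbar x y = RE q l (x : E2) (y : E2) := by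
  have hD := DV_dense hq hl
  have hs : Dense (DV q l ×ˢ DV q l) := hD.prod hD
  set f : ↥(DV q l ×ˢ DV q l) → ℝ := fun p => RE q l (p.1.1 : E2) (p.1.2 : E2) with hf
  have hu : UniformContinuous f := by
    rw [Metric.uniformContinuous_iff]
    intro ε hε
    obtain ⟨δ, hδ, h⟩ := RE_unif hq hl (ε := ε / 2) (by positivity)
    refine ⟨δ, hδ, fun {a b} hab => ?_⟩
    have h1 : dist a.1.1 b.1.1 < δ := lt_of_le_of_lt (le_max_left _ _) hab
    have h2 : dist a.1.2 b.1.2 < δ := lt_of_le_of_lt (le_max_right _ _) hab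
    have h3 := h _ a.2.1 _ b.2.1 h1
    have h4 := h _ a.2.2 _ b.2.2 h2
    rw [Real.dist_eq]
    have := RE_quad hq hl a.2.1 a.2.2 b.2.1 b.2.2
    simp only [hf]
    linarith
  refine ⟨fun x y => hs.extend f (x, y), ?_, ?_⟩
  · exact (hs.uniformContinuous_extend hu).continuous
  · intro x y hx hy
    exact hs.extend_of_ind hu ⟨(x, y), hx, hy⟩

lemma ext_unique {R1 R2 : ↥(Gasket q l) → ↥(Gasket q l) → ℝ}
    (h1 : Continuous (fun p : ↥(Gasket q l) × ↥(Gasket q l) => R1 p.1 p.2))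
    (e1 : ∀ x y : ↥(Gasket q l), (x : E2) ∈ Vstar q l → (y : E2) ∈ Vstar q l →
        R1 x y = RE q l (x : E2) (y : E2))
    (h2 : Continuous (fun p : ↥(Gasket q l) × ↥(Gasket q l) => R2 p.1 p.2))
    (e2 : ∀ x y : ↥(Gasket q l), (x : E2) ∈ Vstar q l → (y : E2) ∈ Vstar q l →
        R2 x y = RE q l (x : E2) (y : E2)) : R1 = R2 := by
  have hD := DV_dense hq hl
  have hs : Dense (DV q l ×ˢ DV q l) := hD.prod hD
  funext x y
  exact dense_forall hs (P := fun p => R1 p.1 p.2 = R2 p.1 p.2) (isClosed_eq h1 h2)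
    (fun p hp => (e1 _ _ hp.1 hp.2).trans (e2 _ _ hp.1 hp.2).symm) (x, y)

lemma ext_props {Rbar : ↥(Gasket q l) → ↥(Gasket q l) → ℝ}
    (hc : Continuous (fun p : ↥(Gasket q l) × ↥(Gasket q l) => Rbar p.1 p.2))
    (he : ∀ x y : ↥(Gasket q l), (x : E2) ∈ Vstar q l → (y : E2) ∈ Vstar q l →
        Rbar x y = RE q l (x : E2) (y : E2)) :
      ((∀ x y : ↥(Gasket q l), 0 ≤ Rbar x y) ∧
       (∀ x y : ↥(Gasket q l), (Rbar x y = 0 ↔ x = y)) ∧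
       (∀ x y : ↥(Gasket q l), Rbar x y = Rbar y x) ∧
       (∀ x y z : ↥(Gasket q l), Rbar x z ≤ Rbar x y + Rbar y z)) ∧
      (∀ (x : ↥(Gasket q l)) (U : Set ↥(Gasket q l)),
        U ∈ nhds x ↔ ∃ ε : ℝ, 0 < ε ∧ {y | Rbar x y < ε} ⊆ U) ∧
      (∀ u : ℕ → ↥(Gasket q l),
        (∀ ε : ℝ, 0 < ε → ∃ N, ∀ j ≥ N, ∀ k ≥ N, Rbar (u j) (u k) < ε) →
        ∃ x : ↥(Gasket q l),
          Filter.Tendsto (fun j => Rbar (u j) x) Filter.atTop (nhds 0)) ∧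
      (∀ x : ↥(Gasket q l), ∀ ε : ℝ, 0 < ε →
        ∃ y : ↥(Gasket q l), (y : E2) ∈ Vstar q l ∧ Rbar x y < ε) := by
  have hD := DV_dense hq hl
  have hs : Dense (DV q l ×ˢ DV q l) := hD.prod hD
  have hs3 : Dense (DV q l ×ˢ (DV q l ×ˢ DV q l)) := hD.prod hs
  have hnn : ∀ x y : ↥(Gasket q l), 0 ≤ Rbar x y := fun x y =>
    dense_forall hs (P := fun p => 0 ≤ Rbar p.1 p.2) (isClosed_le continuous_const hc)
      (fun p hp => by rw [he _ _ hp.1 hp.2]; exact RE_nonneg q _ _) (x, y)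
  have hself : ∀ x : ↥(Gasket q l), Rbar x x = 0 := fun x =>
    dense_forall hD (P := fun p => Rbar p p = 0)
      (isClosed_eq (hc.comp (continuous_id.prodMk continuous_id)) continuous_const)
      (fun p hp => by rw [he _ _ hp hp]; exact RE_self q _) x
  have hsymm : ∀ x y : ↥(Gasket q l), Rbar x y = Rbar y x := fun x y =>
    dense_forall hs (P := fun p => Rbar p.1 p.2 = Rbar p.2 p.1)
      (isClosed_eq hc (hc.comp (continuous_snd.prodMk continuous_fst)))
      (fun p hp => by rw [he _ _ hp.1 hp.2, he _ _ hp.2 hp.1]; exact RE_symm q _ _) (x, y)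
  have htri : ∀ x y z : ↥(Gasket q l), Rbar x z ≤ Rbar x y + Rbar y z := fun x y z =>
    dense_forall hs3 (P := fun p => Rbar p.1 p.2.2 ≤ Rbar p.1 p.2.1 + Rbar p.2.1 p.2.2)
      (isClosed_le (hc.comp (continuous_fst.prodMk (continuous_snd.comp continuous_snd)))
        ((hc.comp (continuous_fst.prodMk (continuous_fst.comp continuous_snd))).add
          (hc.comp continuous_snd)))
      (fun p hp => by
        rw [he _ _ hp.1 hp.2.2, he _ _ hp.1 hp.2.1, he _ _ hp.2.1 hp.2.2]
        exact RE_triangle q hl hp.1 hp.2.1 hp.2.2) (x, y, z)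
  have hdist : ∀ ε : ℝ, 0 < ε → ∃ δ > 0, ∀ x y : ↥(Gasket q l), Rbar x y < δ → dist x y < ε := by
    intro ε hε
    obtain ⟨δ, hδ, h⟩ := dist_unif hq hl (ε := ε / 2) (by positivity)
    refine ⟨δ, hδ, fun x y hxy => ?_⟩
    have hU : IsOpen {p : ↥(Gasket q l) × ↥(Gasket q l) | Rbar p.1 p.2 < δ} :=
      isOpen_lt hc continuous_const
    have h1 := hs.open_subset_closure_inter hU
    have hcl : IsClosed {p : ↥(Gasket q l) × ↥(Gasket q l) | dist p.1 p.2 ≤ ε / 2} :=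
      isClosed_le continuous_dist continuous_const
    have h2 := closure_minimal (s := {p : ↥(Gasket q l) × ↥(Gasket q l) | Rbar p.1 p.2 < δ} ∩ (DV q l ×ˢ DV q l))
      (t := {p : ↥(Gasket q l) × ↥(Gasket q l) | dist p.1 p.2 ≤ ε / 2})
      (fun p hp => (h _ hp.2.1 _ hp.2.2 (by rw [← he _ _ hp.2.1 hp.2.2]; exact hp.1)).le) hcl
    have hm : (x, y) ∈ {p : ↥(Gasket q l) × ↥(Gasket q l) | Rbar p.1 p.2 < δ} := hxy
    have h4 := h2 (h1 hm)
    have h3 : dist x y ≤ ε / 2 := h4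
    linarith
  have hball : ∀ (x : ↥(Gasket q l)) (ε : ℝ), 0 < ε → {y | Rbar x y < ε} ∈ nhds x := by
    intro x ε hε
    apply IsOpen.mem_nhds
    · exact isOpen_lt (hc.comp (continuous_const.prodMk continuous_id)) continuous_const
    · change Rbar x x < ε
      rw [hself]; exact hε
  refine ⟨⟨hnn, fun x y => ⟨fun h => ?_, fun h => by rw [h, hself]⟩, hsymm, htri⟩, ?_, ?_, ?_⟩
  · apply eq_of_forall_dist_le
    intro ε hε
    obtain ⟨δ, hδ, h1⟩ := hdist ε hε
    exact (h1 x y (by rw [h]; exact hδ)).le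
  · intro x U
    constructor
    · intro hU
      obtain ⟨ε, hε, h⟩ := Metric.mem_nhds_iff.1 hU
      obtain ⟨δ, hδ, h1⟩ := hdist ε hε
      refine ⟨δ, hδ, fun y hy => h ?_⟩
      rw [Metric.mem_ball, dist_comm]
      exact h1 x y hy
    · rintro ⟨ε, hε, h⟩
      exact mem_of_superset (hball x ε hε) h
  · intro u hu
    have : CompactSpace ↥(Gasket q l) := isCompact_iff_compactSpace.1 (Gasket_compact q hl)
    have hcau : CauchySeq u := by
      rw [Metric.cauchySeq_iff]
      intro ε hε
      obtain ⟨δ, hδ, h1⟩ := hdist ε hε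
      obtain ⟨N, hN⟩ := hu δ hδ
      exact ⟨N, fun m hm n hn => h1 _ _ (hN m hm n hn)⟩
    obtain ⟨x, hx⟩ := cauchySeq_tendsto_of_complete hcau
    refine ⟨x, ?_⟩
    have h1 : Continuous (fun y => Rbar y x) := hc.comp (continuous_id.prodMk continuous_const)
    have h2 := (h1.tendsto x).comp hx
    rw [hself] at h2
    exact h2
  · intro x ε hε
    obtain ⟨y, hy, hy'⟩ := hD.inter_nhds_nonempty (hball x ε hε)
    exact ⟨y, hy, hy'⟩

end

/-- Comparison of `d` and `R_E` on `V_*`; consequently `R_E` extends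
uniquely to a continuous function on `K × K`, the extension is a metric on `K`
inducing the original topology, and `(K, R̄_E)` is the completion of `(V_*, R_E)`. -/
theorem stmt8 (q : Fin 3 → E2) (hq : ∀ j k : Fin 3, j ≠ k → dist (q j) (q k) = 1)
    (l : ℕ → ℕ) (hl : ∀ n, 5 ≤ l n) :
    -- (1) and (2)
    (∀ x ∈ Vstar q l, ∀ y ∈ Vstar q l, ∀ n : ℕ, 1 ≤ n →
      (gdist q l x y < ((Ln l n : ℝ))⁻¹ → RE q l x y ≤ 4 * Rn l n) ∧
      (RE q l x y < Rn l n / 6 → gdist q l x y ≤ 3 / (Ln l n : ℝ))) ∧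
    -- unique continuous extension of R_E to K × K
    (∃! Rbar : ↥(Gasket q l) → ↥(Gasket q l) → ℝ,
      Continuous (fun p : ↥(Gasket q l) × ↥(Gasket q l) => Rbar p.1 p.2) ∧
      ∀ x y : ↥(Gasket q l), (x : E2) ∈ Vstar q l → (y : E2) ∈ Vstar q l →
        Rbar x y = RE q l (x : E2) (y : E2)) ∧
    -- any such extension is a metric on K inducing the original topology,
    -- and (K, Rbar) is the completion of (V_*, R_E)
    (∀ Rbar : ↥(Gasket q l) → ↥(Gasket q l) → ℝ,
      (Continuous (fun p : ↥(Gasket q l) × ↥(Gasket q l) => Rbar p.1 p.2) ∧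
       ∀ x y : ↥(Gasket q l), (x : E2) ∈ Vstar q l → (y : E2) ∈ Vstar q l →
         Rbar x y = RE q l (x : E2) (y : E2)) →
      -- metric axioms
      ((∀ x y : ↥(Gasket q l), 0 ≤ Rbar x y) ∧
       (∀ x y : ↥(Gasket q l), (Rbar x y = 0 ↔ x = y)) ∧
       (∀ x y : ↥(Gasket q l), Rbar x y = Rbar y x) ∧
       (∀ x y z : ↥(Gasket q l), Rbar x z ≤ Rbar x y + Rbar y z)) ∧
      -- Rbar induces the original topology of K
      (∀ (x : ↥(Gasket q l)) (U : Set ↥(Gasket q l)),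
        U ∈ nhds x ↔ ∃ ε : ℝ, 0 < ε ∧ {y | Rbar x y < ε} ⊆ U) ∧
      -- completeness
      (∀ u : ℕ → ↥(Gasket q l),
        (∀ ε : ℝ, 0 < ε → ∃ N, ∀ j ≥ N, ∀ k ≥ N, Rbar (u j) (u k) < ε) →
        ∃ x : ↥(Gasket q l),
          Filter.Tendsto (fun j => Rbar (u j) x) Filter.atTop (nhds 0)) ∧
      -- density of V_* in K
      (∀ x : ↥(Gasket q l), ∀ ε : ℝ, 0 < ε →
        ∃ y : ↥(Gasket q l), (y : E2) ∈ Vstar q l ∧ Rbar x y < ε)) := by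
  refine ⟨fun x hx y hy n _ => part1 hq hl hx hy n, ?_, ?_⟩
  · obtain ⟨R, h1, h2⟩ := ext_exists hq hl
    exact ⟨R, ⟨h1, h2⟩, fun R' h => ext_unique hq hl h.1 h.2 h1 h2⟩
  · intro Rbar h
    exact ext_props hq hl h.1 h.2
end
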